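/- arXiv:2507.09333 — 3 statements merged into one kernel-verified Lean document; each statement's English description precedes it below -/
import Mathlib

section
/- Let ϱ ∈ L^∞(ℝ²) with ϱ ≥ 0, and suppose there are x₀∈ℝ², r₀>0 and c₀>0 with ∫_{B(x₀,r₀)} ϱ(x) dx ≥ c₀. Then for every p ∈ [1,∞) there exists a constant C>0, depending only on p, ‖ϱ‖_{L^∞} and c₀, such that for every continuously differentiable function f:ℝ²→ℝ one has ‖f‖_{L^p(B(x₀,r₀))} ≤ C r₀^{2/p} ( (1+r₀) ‖∇f‖_{L²(B(x₀,r₀))} + ‖√ϱ f‖_{L²(B(x₀,r₀))} ). -/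
open MeasureTheory

/-- The plane `ℝ²` with its Euclidean structure. -/
abbrev E2 := EuclideanSpace ℝ (Fin 2)

lemma aux_cov (φ : E2 → ENNReal) (hφ : Measurable φ) (x : E2) (t : ℝ) (ht : 0 < t) :
    ∫⁻ y, φ (x + t • (y - x)) = (ENNReal.ofReal t ^ 2)⁻¹ * ∫⁻ z, φ z := by
  have h1 : ∫⁻ y, φ (x + t • (y - x)) = ∫⁻ y : E2, φ (x + t • y) :=
    lintegral_sub_right_eq_self (fun y => φ (x + t • y)) x
  have h2 : ∫⁻ y, φ (x + t • y) = ∫⁻ y, φ (x + y) ∂(Measure.map (fun y : E2 => t • y) volume) := by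
    rw [lintegral_map (f := fun y => φ (x + y)) (by fun_prop) (by fun_prop)]
  rw [h1, h2, Measure.map_addHaar_smul _ ht.ne', lintegral_smul_measure,
    lintegral_add_left_eq_self (fun y => φ y) x]
  simp only [smul_eq_mul, finrank_euclideanSpace, Fintype.card_fin]
  congr 1
  rw [abs_of_pos (by positivity), ENNReal.ofReal_inv_of_pos (by positivity),
    ENNReal.ofReal_pow ht.le]

lemma aux_B1 (ε : ℝ) (hε : 0 < ε) :
    ∫⁻ t in Set.Ioo (0:ℝ) 1, ENNReal.ofReal t ^ (-(1 - ε)) ≠ ⊤ := by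
  have h : IntegrableOn (fun t : ℝ => t ^ (-(1 - ε))) (Set.Ioo 0 1) := by
    rw [intervalIntegral.integrableOn_Ioo_rpow_iff one_pos]; linarith
  have h2 := h.lintegral_lt_top
  refine ne_of_lt (lt_of_le_of_lt (le_of_eq ?_) h2)
  refine setLIntegral_congr_fun measurableSet_Ioo fun t ht => ?_
  exact ENNReal.ofReal_rpow_of_pos ht.1

lemma aux_B2 (ε : ℝ) (hε : 0 < ε) (s : ℝ) (hs : 0 < s) :
    ∫⁻ t in Set.Ioi s, ENNReal.ofReal t ^ (-3 - ε) ≤ ENNReal.ofReal s ^ (-2 - ε) := by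
  have h : IntegrableOn (fun t : ℝ => t ^ (-3 - ε)) (Set.Ioi s) :=
    integrableOn_Ioi_rpow_of_lt (by linarith) hs
  have h1 : ∫⁻ t in Set.Ioi s, ENNReal.ofReal t ^ (-3 - ε)
      = ∫⁻ t in Set.Ioi s, ENNReal.ofReal (t ^ (-3 - ε)) := by
    refine setLIntegral_congr_fun measurableSet_Ioi fun t ht => ?_
    exact ENNReal.ofReal_rpow_of_pos (hs.trans ht)
  rw [h1, ← ofReal_integral_eq_lintegral_ofReal h, integral_Ioi_rpow_of_lt (by linarith) hs,
    ENNReal.ofReal_rpow_of_pos hs]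
  · apply ENNReal.ofReal_le_ofReal
    rw [show -3 - ε + 1 = -(2 + ε) by ring, show -2 - ε = -(2 + ε) by ring, neg_div_neg_eq]
    exact div_le_self (by positivity) (by linarith)
  · exact (ae_restrict_iff' measurableSet_Ioi).2
      (Filter.Eventually.of_forall fun t ht => Real.rpow_nonneg (hs.trans ht).le _)

lemma aux_C : ∫⁻ x in Metric.ball (0 : E2) 1, ‖x‖ₑ⁻¹ ≠ ⊤ := by
  have h := (integrable_fun_norm_addHaar (E := E2) volume
    (f := (Set.Iio (1:ℝ)).indicator fun y => y⁻¹)).2 (by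
      have : IntegrableOn (fun y : ℝ => (1:ℝ)) (Set.Ioo 0 1) := by simp
      have h3 : IntegrableOn ((Set.Ioo (0:ℝ) 1).indicator fun y : ℝ => (1:ℝ)) (Set.Ioi 0) :=
        (this.integrable_indicator measurableSet_Ioo).integrableOn
      refine h3.congr_fun ?_ measurableSet_Ioi
      intro y hy
      have hy' : 0 < y := hy
      by_cases h1 : y < 1
      · simp [Set.indicator, h1, hy', hy'.ne']
      · simp [Set.indicator, h1])
  refine ne_of_lt (lt_of_le_of_lt ?_ h.lintegral_lt_top)
  rw [← lintegral_indicator measurableSet_ball]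
  refine lintegral_mono_ae ?_
  filter_upwards [compl_mem_ae_iff.2 (measure_singleton (0:E2))] with x hx
  have hx : x ≠ 0 := hx
  by_cases h1 : ‖x‖ < 1
  · have : x ∈ Metric.ball (0:E2) 1 := by simpa using h1
    rw [Set.indicator_of_mem this, Set.indicator_of_mem (by exact h1),
      ENNReal.ofReal_inv_of_pos (norm_pos_iff.2 hx), ofReal_norm]
  · have : x ∉ Metric.ball (0:E2) 1 := by simpa using h1
    rw [Set.indicator_of_notMem this]; exact bot_le

lemma aux_jensen {α : Type*} [MeasurableSpace α] (μ : Measure α) (g h : α → ENNReal)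
    (hg : Measurable g) (hh : Measurable h) (q : ℝ) (hq : 1 ≤ q) :
    (∫⁻ a, g a * h a ∂μ) ^ q ≤ (∫⁻ a, g a ∂μ) ^ (q - 1) * ∫⁻ a, g a * h a ^ q ∂μ := by
  have hq0 : 0 < q := by linarith
  have H := eLpNorm'_le_eLpNorm'_mul_rpow_measure_univ (μ := μ.withDensity g) (f := h)
    one_pos hq hh.aestronglyMeasurable
  simp only [eLpNorm', enorm_eq_self, ENNReal.rpow_one, div_one] at H
  rw [lintegral_withDensity_eq_lintegral_mul _ hg hh,
    lintegral_withDensity_eq_lintegral_mul _ hg (hh.pow_const q),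
    withDensity_apply _ MeasurableSet.univ, Measure.restrict_univ] at H
  have H2 := ENNReal.rpow_le_rpow H hq0.le
  rw [ENNReal.mul_rpow_of_nonneg _ _ hq0.le, ← ENNReal.rpow_mul, ← ENNReal.rpow_mul,
    one_div_mul_cancel hq0.ne', ENNReal.rpow_one, mul_comm (∫⁻ a, (g * fun x => h x ^ q) a ∂μ)] at H2
  rw [show (1 - 1 / q) * q = q - 1 by field_simp] at H2
  exact H2

lemma aux_line (f : E2 → ℝ) (hf : ContDiff ℝ 1 f) (ε : ℝ) (x y : E2) :
    ‖f x - f y‖ₑ ^ 2 ≤ (∫⁻ t in Set.Ioo (0:ℝ) 1, ENNReal.ofReal t ^ (-(1 - ε))) *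
      ∫⁻ t in Set.Ioo (0:ℝ) 1, ENNReal.ofReal t ^ (1 - ε) *
        (‖y - x‖ₑ ^ 2 * ‖fderiv ℝ f (x + t • (y - x))‖ₑ ^ 2) := by
  have hc : Continuous (fderiv ℝ f) := hf.continuous_fderiv (by simp)
  have h1 : ∫ t in (0:ℝ)..1, (fderiv ℝ f (x + t • (y - x))) (y - x)
      = f (x + (1:ℝ) • (y - x)) - f (x + (0:ℝ) • (y - x)) := by
    refine intervalIntegral.integral_eq_sub_of_hasDerivAt
      (f := fun t : ℝ => f (x + t • (y - x))) (fun t _ => ?_) ?_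
    · have hd : HasDerivAt (fun t : ℝ => x + t • (y - x)) (y - x) t := by
        simpa using ((hasDerivAt_id t).smul_const (y - x)).const_add x
      exact ((hf.differentiable (by simp)) _).hasFDerivAt.comp_hasDerivAt t hd
    · apply Continuous.intervalIntegrable
      fun_prop
  have h2 : ‖f x - f y‖ₑ ≤ ∫⁻ t in Set.Ioo (0:ℝ) 1,
      ‖y - x‖ₑ * ‖fderiv ℝ f (x + t • (y - x))‖ₑ := by
    rw [← enorm_neg, neg_sub]
    simp only [one_smul, zero_smul, add_zero, add_sub_cancel] at h1
    rw [← h1, intervalIntegral.integral_of_le zero_le_one, ← restrict_Ioo_eq_restrict_Ioc]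
    refine (enorm_integral_le_lintegral_enorm _).trans (lintegral_mono fun t => ?_)
    rw [mul_comm]
    exact ContinuousLinearMap.le_opENorm _ _
  have h3 := ENNReal.lintegral_mul_le_Lp_mul_Lq (volume.restrict (Set.Ioo (0:ℝ) 1))
    (Real.HolderConjugate.two_two) 
    (f := fun t => ENNReal.ofReal t ^ (-(1 - ε) / 2))
    (g := fun t => ENNReal.ofReal t ^ ((1 - ε) / 2) *
      (‖y - x‖ₑ * ‖fderiv ℝ f (x + t • (y - x))‖ₑ)) (by fun_prop) (by fun_prop)
  have h4 : ‖f x - f y‖ₑ ≤ _ := h2.trans (le_trans (le_of_eq ?_) h3)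
  · have h5 := pow_le_pow_left' h4 2
    rw [mul_pow] at h5
    simp only [← ENNReal.rpow_natCast, ← ENNReal.rpow_mul] at h5 ⊢
    norm_num at h5 ⊢
    convert h5 using 3
    · ext t
      ring_nf
    · ext t
      rw [mul_pow, ← ENNReal.rpow_mul_natCast, mul_pow]
      congr 2
      push_cast; ring
  · refine setLIntegral_congr_fun measurableSet_Ioo fun t ht => ?_
    simp only [Pi.mul_apply]
    rw [← mul_assoc, ← ENNReal.rpow_add _ _ (by simpa using ht.1) ENNReal.ofReal_ne_top,
      show -(1 - ε) / 2 + (1 - ε) / 2 = 0 by ring, ENNReal.rpow_zero, one_mul]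

lemma aux_inner (G : E2 → ENNReal) (hG : Measurable G) (x₀ x : E2) (r : ℝ) (hr : 0 < r)
    (hx : x ∈ Metric.ball x₀ r) (t : ℝ) (ht : t ∈ Set.Ioo (0:ℝ) 1) :
    ∫⁻ y in Metric.ball x₀ r, ‖y - x‖ₑ ^ 2 * G (x + t • (y - x)) ≤
      ENNReal.ofReal t ^ (-4 : ℝ) * ∫⁻ z in Metric.ball x₀ r,
        (Set.Ioi (‖z - x‖ / (2 * r))).indicator 1 t * (‖z - x‖ₑ ^ 2 * G z) := by
  have ht0 : ENNReal.ofReal t ≠ 0 := by simpa using ht.1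
  have htt : ENNReal.ofReal t ≠ ⊤ := ENNReal.ofReal_ne_top
  set φ : E2 → ENNReal := (Metric.ball x₀ r).indicator fun z =>
    (Set.Ioi (‖z - x‖ / (2 * r))).indicator 1 t * (‖z - x‖ₑ ^ 2 * G z) with hφ
  have hφm : Measurable φ := by
    refine Measurable.indicator ?_ measurableSet_ball
    refine Measurable.mul ?_ (by fun_prop)
    have : (fun z : E2 => (Set.Ioi (‖z - x‖ / (2 * r))).indicator (1 : ℝ → ENNReal) t)
        = {z : E2 | ‖z - x‖ / (2 * r) < t}.indicator 1 := by
      ext z; simp [Set.indicator]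
    rw [this]
    exact measurable_one.indicator (measurableSet_lt (by fun_prop) (by fun_prop))
  have h1 : ∫⁻ y in Metric.ball x₀ r, ‖y - x‖ₑ ^ 2 * G (x + t • (y - x)) ≤
      ∫⁻ y, (ENNReal.ofReal t ^ 2)⁻¹ * φ (x + t • (y - x)) := by
    rw [← lintegral_indicator measurableSet_ball]
    refine lintegral_mono fun y => ?_
    by_cases hy : y ∈ Metric.ball x₀ r
    · have hz : x + t • (y - x) ∈ Metric.ball x₀ r :=
        (convex_ball x₀ r).add_smul_sub_mem hx hy ⟨ht.1.le, ht.2.le⟩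
      have hd : ‖y - x‖ < 2 * r := by
        rw [← dist_eq_norm]
        have := dist_triangle_right y x x₀
        rw [Metric.mem_ball] at hx hy; linarith
      have hm : t ∈ Set.Ioi (‖x + t • (y - x) - x‖ / (2 * r)) := by
        rw [Set.mem_Ioi, div_lt_iff₀ (by positivity), add_sub_cancel_left, norm_smul,
          Real.norm_of_nonneg ht.1.le]
        exact mul_lt_mul_of_pos_left hd ht.1
      rw [Set.indicator_of_mem hy, hφ, Set.indicator_of_mem hz, Set.indicator_of_mem hm]
      simp only [Pi.one_apply, one_mul, add_sub_cancel_left, enorm_smul, mul_pow]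
      rw [Real.enorm_of_nonneg ht.1.le, ← mul_assoc, ← mul_assoc,
        ENNReal.inv_mul_cancel (by simpa using ht.1) (by simp), one_mul]
    · rw [Set.indicator_of_notMem hy]; exact bot_le
  refine h1.trans (le_of_eq ?_)
  rw [lintegral_const_mul _ (by fun_prop), aux_cov φ hφm x t ht.1, ← mul_assoc,
    hφ, lintegral_indicator measurableSet_ball]
  congr 1
  rw [ENNReal.rpow_neg, ← ENNReal.mul_inv (by simp) (by simp), ← pow_add]
  congr 1
  rw [← ENNReal.rpow_natCast]; norm_num

lemma aux_K (f : E2 → ℝ) (hf : ContDiff ℝ 1 f) (ε : ℝ) (hε : 0 < ε) (x₀ x : E2) (r : ℝ)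
    (hr : 0 < r) (hx : x ∈ Metric.ball x₀ r) :
    ∫⁻ y in Metric.ball x₀ r, ‖f x - f y‖ₑ ^ 2 ≤
      (∫⁻ t in Set.Ioo (0:ℝ) 1, ENNReal.ofReal t ^ (-(1 - ε))) * (ENNReal.ofReal (2 * r) ^ 2 *
        ∫⁻ z in Metric.ball x₀ r, ‖fderiv ℝ f z‖ₑ ^ 2 *
          (‖z - x‖ₑ / ENNReal.ofReal (2 * r)) ^ (-ε)) := by
  have hc : Continuous (fderiv ℝ f) := hf.continuous_fderiv (by simp)
  have hm : Measurable fun z => ‖fderiv ℝ f z‖ₑ ^ 2 := by fun_prop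
  refine (lintegral_mono fun y => aux_line f hf ε x y).trans ?_
  rw [lintegral_const_mul' _ _ (aux_B1 ε hε)]
  gcongr
  rw [lintegral_lintegral_swap (by
    apply Measurable.aemeasurable
    have : Measurable fun z : E2 × ℝ => fderiv ℝ f (x + z.2 • (z.1 - x)) :=
      (hc.comp (by fun_prop)).measurable
    simp only [Function.uncurry_def]
    fun_prop)]
  have h1 : ∀ t ∈ Set.Ioo (0:ℝ) 1, ∫⁻ y in Metric.ball x₀ r, ENNReal.ofReal t ^ (1 - ε) *
        (‖y - x‖ₑ ^ 2 * ‖fderiv ℝ f (x + t • (y - x))‖ₑ ^ 2) ≤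
      ∫⁻ z in Metric.ball x₀ r, (ENNReal.ofReal t ^ (-3 - ε) *
        (Set.Ioi (‖z - x‖ / (2 * r))).indicator 1 t) * (‖z - x‖ₑ ^ 2 * ‖fderiv ℝ f z‖ₑ ^ 2) := by
    intro t ht
    have ht0 : ENNReal.ofReal t ≠ 0 := by simpa using ht.1
    rw [lintegral_const_mul _ (by fun_prop)]
    refine (mul_le_mul_right (aux_inner _ hm x₀ x r hr hx t ht) _).trans ?_
    rw [← mul_assoc, ← ENNReal.rpow_add _ _ ht0 ENNReal.ofReal_ne_top,
      ← lintegral_const_mul' _ _ (by simp [ENNReal.rpow_eq_top_iff, ht.1.not_ge])]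
    rw [show 1 - ε + -4 = -3 - ε by ring]
    simp only [mul_assoc]
    exact le_rfl
  refine (setLIntegral_mono' measurableSet_Ioo h1).trans ?_
  rw [lintegral_lintegral_swap (by
    apply Measurable.aemeasurable
    simp only [Function.uncurry_def]
    refine Measurable.mul (Measurable.mul (by fun_prop) ?_) (by fun_prop)
    have : (fun z : ℝ × E2 => (Set.Ioi (‖z.2 - x‖ / (2 * r))).indicator (1 : ℝ → ENNReal) z.1)
        = {z : ℝ × E2 | ‖z.2 - x‖ / (2 * r) < z.1}.indicator 1 := by
      ext z; simp [Set.indicator]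
    rw [this]
    exact measurable_one.indicator (measurableSet_lt (by fun_prop) (by fun_prop)))]
  rw [← lintegral_const_mul' _ _ (by finiteness)]
  refine lintegral_mono_ae (ae_restrict_of_ae ?_)
  filter_upwards [compl_mem_ae_iff.2 (measure_singleton x)] with z hz
  have hz : 0 < ‖z - x‖ := norm_pos_iff.2 (sub_ne_zero.2 hz)
  set s := ‖z - x‖ / (2 * r) with hs
  have hs0 : 0 < s := by positivity
  have hsE : ‖z - x‖ₑ / ENNReal.ofReal (2 * r) = ENNReal.ofReal s := by
    rw [hs, ENNReal.ofReal_div_of_pos (by positivity), ofReal_norm]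
  have hsE2 : ‖z - x‖ₑ = ENNReal.ofReal (2 * r) * ENNReal.ofReal s := by
    rw [← ENNReal.ofReal_mul (by positivity), hs, ← ofReal_norm]
    congr 1; field_simp
  have hs0' : ENNReal.ofReal s ≠ 0 := by simpa using hs0
  rw [lintegral_mul_const' _ _ (by finiteness), hsE]
  have h2 : ∫⁻ t in Set.Ioo (0:ℝ) 1, ENNReal.ofReal t ^ (-3 - ε) * (Set.Ioi s).indicator 1 t
      ≤ ENNReal.ofReal s ^ (-2 - ε) := by
    refine le_trans ?_ (aux_B2 ε hε s hs0)
    refine (setLIntegral_le_lintegral _ _).trans ?_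
    rw [← lintegral_indicator measurableSet_Ioi]
    refine lintegral_mono fun t => ?_
    by_cases h : t ∈ Set.Ioi s
    · simp only [Set.indicator_of_mem h, Pi.one_apply, mul_one]; exact le_rfl
    · simp only [Set.indicator_of_notMem h, mul_zero]; exact le_rfl
  refine (mul_le_mul_left h2 _).trans (le_of_eq ?_)
  rw [hsE2, show -ε = (-2 - ε) + (2:ℕ) by push_cast; ring,
    ENNReal.rpow_add _ _ hs0' ENNReal.ofReal_ne_top, ENNReal.rpow_natCast]
  ring

lemma aux_ker (x₀ z : E2) (r : ℝ) (hr : 0 < r) (hz : z ∈ Metric.ball x₀ r) :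
    ∫⁻ x in Metric.ball x₀ r, (‖z - x‖ₑ / ENNReal.ofReal (2 * r))⁻¹ ≤
      ENNReal.ofReal (2 * r) ^ 2 * ∫⁻ x in Metric.ball (0 : E2) 1, ‖x‖ₑ⁻¹ := by
  have ht : 0 < (2 * r)⁻¹ := by positivity
  set ψ : E2 → ENNReal := (Metric.ball (0:E2) 1).indicator fun x => ‖x‖ₑ⁻¹ with hψ
  have hψm : Measurable ψ := Measurable.indicator (by fun_prop) measurableSet_ball
  have h1 := aux_cov (fun w => ψ (w - z)) (by fun_prop) z (2 * r)⁻¹ ht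
  rw [lintegral_sub_right_eq_self ψ z, hψ, lintegral_indicator measurableSet_ball, ← hψ] at h1
  rw [ENNReal.ofReal_inv_of_pos (by positivity), ENNReal.inv_pow, inv_inv] at h1
  rw [← h1, ← lintegral_indicator measurableSet_ball]
  refine lintegral_mono fun x => ?_
  by_cases hx : x ∈ Metric.ball x₀ r
  · have hd : ‖x - z‖ < 2 * r := by
      rw [← dist_eq_norm]
      have := dist_triangle_right x z x₀
      rw [Metric.mem_ball] at hx hz; linarith
    have hm : (2 * r)⁻¹ • (x - z) ∈ Metric.ball (0:E2) 1 := by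
      rw [mem_ball_zero_iff, norm_smul, Real.norm_of_nonneg ht.le, inv_mul_lt_iff₀ (by positivity)]
      linarith
    rw [Set.indicator_of_mem hx, add_sub_cancel_left, hψ, Set.indicator_of_mem hm, enorm_smul,
      Real.enorm_of_nonneg ht.le, ENNReal.ofReal_inv_of_pos (by positivity), div_eq_mul_inv,
      mul_comm, ← enorm_neg (x - z), neg_sub]
  · rw [Set.indicator_of_notMem hx]; exact bot_le

lemma aux_PS (f : E2 → ℝ) (hf : ContDiff ℝ 1 f) (q : ℝ) (hq : 1 ≤ q) (x₀ : E2) (r : ℝ)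
    (hr : 0 < r) :
    ∫⁻ x in Metric.ball x₀ r, (∫⁻ y in Metric.ball x₀ r, ‖f x - f y‖ₑ ^ 2) ^ q ≤
      ((∫⁻ t in Set.Ioo (0:ℝ) 1, ENNReal.ofReal t ^ (-(1 - 1 / q))) *
        ENNReal.ofReal (2 * r) ^ 2) ^ q *
      ((∫⁻ z in Metric.ball x₀ r, ‖fderiv ℝ f z‖ₑ ^ 2) ^ q *
        (ENNReal.ofReal (2 * r) ^ 2 * ∫⁻ x in Metric.ball (0 : E2) 1, ‖x‖ₑ⁻¹)) := by
  have hq0 : 0 < q := by linarith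
  have hc : Continuous (fderiv ℝ f) := hf.continuous_fderiv (by simp)
  have hm : Measurable fun z => ‖fderiv ℝ f z‖ₑ ^ 2 := by fun_prop
  have hA := aux_B1 (1 / q) (by positivity)
  set A := ∫⁻ t in Set.Ioo (0:ℝ) 1, ENNReal.ofReal t ^ (-(1 - 1 / q)) with hAdef
  set R := ENNReal.ofReal (2 * r) with hR
  have hRt : R ≠ ⊤ := ENNReal.ofReal_ne_top
  set N := ∫⁻ z in Metric.ball x₀ r, ‖fderiv ℝ f z‖ₑ ^ 2 with hN
  have h1 : ∀ x ∈ Metric.ball x₀ r, (∫⁻ y in Metric.ball x₀ r, ‖f x - f y‖ₑ ^ 2) ^ q ≤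
      (A * R ^ 2) ^ q * N ^ (q - 1) * ∫⁻ z in Metric.ball x₀ r, ‖fderiv ℝ f z‖ₑ ^ 2 *
        (‖z - x‖ₑ / R)⁻¹ := by
    intro x hx
    refine (ENNReal.rpow_le_rpow (aux_K f hf (1 / q) (by positivity) x₀ x r hr hx) hq0.le).trans ?_
    rw [← mul_assoc, ENNReal.mul_rpow_of_nonneg _ _ hq0.le, mul_assoc]
    gcongr
    refine (aux_jensen _ _ _ hm (by fun_prop) q hq).trans (le_of_eq ?_)
    congr 2
    ext z
    rw [← ENNReal.rpow_mul, show -(1 / q) * q = -1 by field_simp, ENNReal.rpow_neg_one]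
  refine (setLIntegral_mono' measurableSet_ball h1).trans ?_
  rw [lintegral_const_mul _ (Measurable.lintegral_prod_right' (f := fun w : E2 × E2 =>
    ‖fderiv ℝ f w.2‖ₑ ^ 2 * (‖w.2 - w.1‖ₑ / R)⁻¹) (by fun_prop)), lintegral_lintegral_swap (by
    apply Measurable.aemeasurable
    simp only [Function.uncurry_def]
    fun_prop), mul_assoc]
  refine mul_le_mul_right ?_ _
  have h2 : ∫⁻ z in Metric.ball x₀ r, ∫⁻ x in Metric.ball x₀ r, ‖fderiv ℝ f z‖ₑ ^ 2 *
      (‖z - x‖ₑ / R)⁻¹ ≤ N * (R ^ 2 * ∫⁻ x in Metric.ball (0 : E2) 1, ‖x‖ₑ⁻¹) := by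
    rw [hN, ← lintegral_mul_const _ hm]
    refine setLIntegral_mono' measurableSet_ball fun z hz => ?_
    rw [lintegral_const_mul _ (by fun_prop)]
    gcongr
    exact aux_ker x₀ z r hr hz
  refine (mul_le_mul_right h2 _).trans (le_of_eq ?_)
  rw [← mul_assoc]
  congr 1
  conv_rhs => rw [show q = (q - 1) + 1 by ring,
    ENNReal.rpow_add_of_nonneg _ _ (by linarith) zero_le_one, ENNReal.rpow_one]

lemma aux_core (q M c₀ : ℝ) (hq : 1 ≤ q) (hc₀ : 0 < c₀) :
    ∃ C : ENNReal, C ≠ ⊤ ∧ ∀ (ϱ : E2 → ℝ) (x₀ : E2) (r : ℝ) (f : E2 → ℝ),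
      Measurable ϱ → (∀ x, ϱ x ≤ M) → 0 < r →
      ENNReal.ofReal c₀ ≤ (∫⁻ x in Metric.ball x₀ r, ENNReal.ofReal (ϱ x)) →
      ContDiff ℝ 1 f →
      ∫⁻ x in Metric.ball x₀ r, (‖f x‖ₑ ^ 2) ^ q ≤ C * ENNReal.ofReal r ^ 2 *
        (ENNReal.ofReal r ^ 2 * (∫⁻ x in Metric.ball x₀ r, ‖fderiv ℝ f x‖ₑ ^ 2) +
          ∫⁻ x in Metric.ball x₀ r, ENNReal.ofReal (ϱ x) * ‖f x‖ₑ ^ 2) ^ q := by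
  have hq0 : 0 < q := by linarith
  have hA := aux_B1 (1 / q) (by positivity)
  have hC := aux_C
  set A := ∫⁻ t in Set.Ioo (0:ℝ) 1, ENNReal.ofReal t ^ (-(1 - 1 / q)) with hAdef
  set C1 := ∫⁻ x in Metric.ball (0 : E2) 1, ‖x‖ₑ⁻¹ with hC1
  set m := ENNReal.ofReal M with hm
  set c := ENNReal.ofReal c₀ with hc
  have hc0 : c ≠ 0 := by simpa [hc] using hc₀
  have hct : c ≠ ⊤ := ENNReal.ofReal_ne_top
  have hmt : m ≠ ⊤ := ENNReal.ofReal_ne_top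
  refine ⟨(c⁻¹ * 2) ^ q * 2 ^ (q - 1) *
    (m ^ q * ((A * 4) ^ q * (4 * C1)) + ENNReal.ofReal Real.pi), ?_, ?_⟩
  · have h2 : (c⁻¹ * 2) ^ q ≠ ⊤ := ENNReal.rpow_ne_top_of_nonneg hq0.le
      (ENNReal.mul_ne_top (by simpa using hc0) (by simp))
    have h3 : (2 : ENNReal) ^ (q - 1) ≠ ⊤ := ENNReal.rpow_ne_top_of_nonneg (by linarith) (by simp)
    have h4 : m ^ q ≠ ⊤ := ENNReal.rpow_ne_top_of_nonneg hq0.le hmt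
    have h5 : (A * 4) ^ q ≠ ⊤ := ENNReal.rpow_ne_top_of_nonneg hq0.le
      (ENNReal.mul_ne_top hA (by simp))
    finiteness
  intro ϱ x₀ r f hϱ hϱM hr hcϱ hf
  have hfc := hf.continuous
  have hPS := aux_PS f hf q hq x₀ r hr
  rw [← hAdef, ← hC1] at hPS
  set N := ∫⁻ x in Metric.ball x₀ r, ‖fderiv ℝ f x‖ₑ ^ 2
  set W := ∫⁻ x in Metric.ball x₀ r, ENNReal.ofReal (ϱ x) * ‖f x‖ₑ ^ 2 with hW
  set ρ := ENNReal.ofReal r with hρ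
  have h2r : ENNReal.ofReal (2 * r) ^ 2 = 4 * ρ ^ 2 := by
    rw [ENNReal.ofReal_mul zero_le_two, mul_pow, hρ]; norm_num
  rw [h2r] at hPS
  have sq2 : ∀ a b : ENNReal, (a + b) ^ 2 ≤ 2 * (a ^ 2 + b ^ 2) := by
    intro a b
    have := ENNReal.rpow_add_le_mul_rpow_add_rpow a b (p := 2) (by norm_num)
    norm_num at this
    exact this
  have h1 : ∀ x, c * ‖f x‖ₑ ^ 2 ≤
      2 * (m * (∫⁻ y in Metric.ball x₀ r, ‖f x - f y‖ₑ ^ 2) + W) := by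
    intro x
    calc c * ‖f x‖ₑ ^ 2 ≤ (∫⁻ y in Metric.ball x₀ r, ENNReal.ofReal (ϱ y)) * ‖f x‖ₑ ^ 2 := by gcongr
      _ = ∫⁻ y in Metric.ball x₀ r, ENNReal.ofReal (ϱ y) * ‖f x‖ₑ ^ 2 := by
          rw [lintegral_mul_const _ (by fun_prop)]
      _ ≤ ∫⁻ y in Metric.ball x₀ r, 2 * (m * ‖f x - f y‖ₑ ^ 2 + ENNReal.ofReal (ϱ y) * ‖f y‖ₑ ^ 2) := by
          refine lintegral_mono fun y => ?_
          have e1 : ‖f x‖ₑ ≤ ‖f x - f y‖ₑ + ‖f y‖ₑ := by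
            simpa using enorm_add_le (f x - f y) (f y)
          calc ENNReal.ofReal (ϱ y) * ‖f x‖ₑ ^ 2
              ≤ ENNReal.ofReal (ϱ y) * (2 * (‖f x - f y‖ₑ ^ 2 + ‖f y‖ₑ ^ 2)) := by
                gcongr
                exact (pow_le_pow_left' e1 2).trans (sq2 _ _)
            _ = 2 * (ENNReal.ofReal (ϱ y) * ‖f x - f y‖ₑ ^ 2 + ENNReal.ofReal (ϱ y) * ‖f y‖ₑ ^ 2) := by
                ring
            _ ≤ _ := by
                gcongr
                exact ENNReal.ofReal_le_ofReal (hϱM y)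
      _ = _ := by
          rw [lintegral_const_mul _ (by fun_prop), lintegral_add_left (by fun_prop),
            lintegral_const_mul _ (by fun_prop)]
  have h2 : ∀ x, (‖f x‖ₑ ^ 2) ^ q ≤ (c⁻¹ * 2) ^ q * 2 ^ (q - 1) *
      (m ^ q * (∫⁻ y in Metric.ball x₀ r, ‖f x - f y‖ₑ ^ 2) ^ q + W ^ q) := by
    intro x
    have : ‖f x‖ₑ ^ 2 ≤ (c⁻¹ * 2) * (m * (∫⁻ y in Metric.ball x₀ r, ‖f x - f y‖ₑ ^ 2) + W) := by
      calc ‖f x‖ₑ ^ 2 = c⁻¹ * (c * ‖f x‖ₑ ^ 2) := by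
            rw [← mul_assoc, ENNReal.inv_mul_cancel hc0 hct, one_mul]
        _ ≤ _ := by rw [mul_assoc]; exact mul_le_mul_right (h1 x) _
    refine (ENNReal.rpow_le_rpow this hq0.le).trans ?_
    rw [ENNReal.mul_rpow_of_nonneg _ _ hq0.le, mul_assoc, ← ENNReal.mul_rpow_of_nonneg m _ hq0.le]
    gcongr
    exact ENNReal.rpow_add_le_mul_rpow_add_rpow _ _ hq
  have hKm : Measurable fun x => (∫⁻ y in Metric.ball x₀ r, ‖f x - f y‖ₑ ^ 2) ^ q := by
    refine Measurable.pow_const ?_ q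
    exact Measurable.lintegral_prod_right' (f := fun w : E2 × E2 => ‖f w.1 - f w.2‖ₑ ^ 2)
      (by fun_prop)
  refine (lintegral_mono h2).trans ?_
  rw [lintegral_const_mul _ (by fun_prop), lintegral_add_left (by fun_prop),
    lintegral_const_mul _ hKm, lintegral_const, Measure.restrict_apply_univ,
    EuclideanSpace.volume_ball_fin_two]
  rw [mul_assoc _ (ρ ^ 2), mul_assoc _ _ (ρ ^ 2 * _)]
  refine mul_le_mul_right ?_ _
  rw [← hρ]
  calc _ ≤ m ^ q * ((A * (4 * ρ ^ 2)) ^ q * (N ^ q * (4 * ρ ^ 2 * C1))) +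
        W ^ q * (ρ ^ 2 * ENNReal.ofReal Real.pi) := by gcongr
    _ = m ^ q * ((A * 4) ^ q * (4 * C1)) * (ρ ^ 2 * (ρ ^ 2 * N) ^ q) +
        ENNReal.ofReal Real.pi * (ρ ^ 2 * W ^ q) := by
        rw [← mul_assoc A, ENNReal.mul_rpow_of_nonneg (A * 4) _ hq0.le,
          ENNReal.mul_rpow_of_nonneg (ρ ^ 2) _ hq0.le]
        ring
    _ ≤ m ^ q * ((A * 4) ^ q * (4 * C1)) * (ρ ^ 2 * (ρ ^ 2 * N + W) ^ q) +
        ENNReal.ofReal Real.pi * (ρ ^ 2 * (ρ ^ 2 * N + W) ^ q) := by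
        gcongr
        · exact le_self_add
        · exact le_add_self
    _ = _ := by ring

lemma aux_all (p M c₀ : ℝ) (hp : 1 ≤ p) (hc₀ : 0 < c₀) :
    ∃ C : ENNReal, C ≠ ⊤ ∧ ∀ (ϱ : E2 → ℝ) (x₀ : E2) (r : ℝ) (f : E2 → ℝ),
      Measurable ϱ → (∀ x, ϱ x ≤ M) → 0 < r →
      ENNReal.ofReal c₀ ≤ (∫⁻ x in Metric.ball x₀ r, ENNReal.ofReal (ϱ x)) →
      ContDiff ℝ 1 f →
      ∫⁻ x in Metric.ball x₀ r, ‖f x‖ₑ ^ p ≤ C * ENNReal.ofReal r ^ 2 *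
        (ENNReal.ofReal r ^ 2 * (∫⁻ x in Metric.ball x₀ r, ‖fderiv ℝ f x‖ₑ ^ 2) +
          ∫⁻ x in Metric.ball x₀ r, ENNReal.ofReal (ϱ x) * ‖f x‖ₑ ^ 2) ^ (p / 2) := by
  have hp0 : 0 < p := by linarith
  rcases le_total 2 p with h2 | h2
  · obtain ⟨C, hC, H⟩ := aux_core (p / 2) M c₀ (by linarith) hc₀
    refine ⟨C, hC, fun ϱ x₀ r f h1 h2 h3 h4 h5 => ?_⟩
    refine le_trans (le_of_eq ?_) (H ϱ x₀ r f h1 h2 h3 h4 h5)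
    congr 1
    ext x
    rw [← ENNReal.rpow_natCast_mul]
    congr 1
    push_cast; ring
  · obtain ⟨C, hC, H⟩ := aux_core 1 M c₀ le_rfl hc₀
    refine ⟨(ENNReal.ofReal Real.pi ^ (2 / p - 1) * C) ^ (p / 2), ?_,
      fun ϱ x₀ r f h1 h2' h3 h4 h5 => ?_⟩
    · have : 0 ≤ 2 / p - 1 := by rw [sub_nonneg, le_div_iff₀ hp0]; linarith
      exact ENNReal.rpow_ne_top_of_nonneg (by positivity) (ENNReal.mul_ne_top
        (ENNReal.rpow_ne_top_of_nonneg this ENNReal.ofReal_ne_top) hC)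
    have H' := H ϱ x₀ r f h1 h2' h3 h4 h5
    have hfc := h5.continuous
    simp only [ENNReal.rpow_one] at H'
    set X := (ENNReal.ofReal r ^ 2 * (∫⁻ x in Metric.ball x₀ r, ‖fderiv ℝ f x‖ₑ ^ 2) +
          ∫⁻ x in Metric.ball x₀ r, ENNReal.ofReal (ϱ x) * ‖f x‖ₑ ^ 2)
    set ρ := ENNReal.ofReal r with hρ
    have hρ0 : ρ ^ 2 ≠ 0 := by simpa [hρ] using h3
    have hρt : ρ ^ 2 ≠ ⊤ := by rw [hρ]; finiteness
    have hq : 1 ≤ 2 / p := by rw [le_div_iff₀ hp0]; linarith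
    have J := aux_jensen (volume.restrict (Metric.ball x₀ r)) (fun _ => 1) (fun x => ‖f x‖ₑ ^ p)
      (by fun_prop) (by fun_prop) (2 / p) hq
    simp only [one_mul, lintegral_const, Measure.restrict_apply_univ,
      EuclideanSpace.volume_ball_fin_two, ← ENNReal.rpow_mul, mul_div_cancel₀ _ hp0.ne'] at J
    simp only [ENNReal.rpow_two] at J
    have J2 := J.trans (mul_le_mul_right H' _)
    have J3 := ENNReal.rpow_le_rpow J2 (show 0 ≤ p / 2 by positivity)
    rw [← ENNReal.rpow_mul, show 2 / p * (p / 2) = 1 by field_simp, ENNReal.rpow_one] at J3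
    refine J3.trans (le_of_eq ?_)
    rw [← hρ, ENNReal.mul_rpow_of_nonneg _ _ (show 0 ≤ 2 / p - 1 by linarith)]
    have e : (ρ ^ 2) ^ (2 / p - 1) * ρ ^ 2 = (ρ ^ 2) ^ (2 / p) := by
      conv_rhs => rw [show 2 / p = (2 / p - 1) + 1 by ring, ENNReal.rpow_add _ _ hρ0 hρt,
        ENNReal.rpow_one]
    calc _ = (ENNReal.ofReal Real.pi ^ (2 / p - 1) * C *
          (((ρ ^ 2) ^ (2 / p - 1) * ρ ^ 2) * X)) ^ (p / 2) := by congr 1; ring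
      _ = _ := by
        rw [e, ENNReal.mul_rpow_of_nonneg _ _ (show 0 ≤ p / 2 by positivity),
          ENNReal.mul_rpow_of_nonneg _ X (show 0 ≤ p / 2 by positivity), ← ENNReal.rpow_mul,
          show 2 / p * (p / 2) = 1 by field_simp, ENNReal.rpow_one, mul_assoc]

lemma aux_norm_gradient (f : E2 → ℝ) (x : E2) : ‖gradient f x‖ = ‖fderiv ℝ f x‖ := by
  simp [gradient]

lemma aux_intOn (g : E2 → ℝ) (hg : Continuous g) (x₀ : E2) (r : ℝ) :
    IntegrableOn g (Metric.ball x₀ r) :=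
  (hg.continuousOn.integrableOn_compact (isCompact_closedBall x₀ r)).mono_set
    Metric.ball_subset_closedBall

/-- local control of `‖f‖_{L^p(B)}` by `‖∇f‖_{L²(B)}` and `‖√ϱ f‖_{L²(B)}`
when the weight `ϱ ≥ 0` has mass at least `c₀` on the ball `B`.  The constant `C`
depends only on `p`, on the `L^∞` bound `M` for `ϱ`, and on `c₀`. -/
theorem local_Lp_control_by_weighted_L2
    (p M c₀ : ℝ) (hp : 1 ≤ p) (hM : 0 ≤ M) (hc₀ : 0 < c₀) :
    ∃ C > 0, ∀ (ϱ : E2 → ℝ) (x₀ : E2) (r₀ : ℝ) (f : E2 → ℝ),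
      Measurable ϱ → (∀ x, 0 ≤ ϱ x) → (∀ x, ϱ x ≤ M) → 0 < r₀ →
      c₀ ≤ (∫ x in Metric.ball x₀ r₀, ϱ x) →
      ContDiff ℝ 1 f →
      (∫ x in Metric.ball x₀ r₀, |f x| ^ p) ^ (1 / p)
        ≤ C * r₀ ^ (2 / p) *
            ((1 + r₀) * Real.sqrt (∫ x in Metric.ball x₀ r₀, ‖gradient f x‖ ^ 2)
              + Real.sqrt (∫ x in Metric.ball x₀ r₀, (Real.sqrt (ϱ x) * f x) ^ 2)) := by
  have hp0 : 0 < p := by linarith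
  obtain ⟨C, hC, H⟩ := aux_all p M c₀ hp hc₀
  refine ⟨C.toReal ^ (1 / p) + 1, by positivity, ?_⟩
  intro ϱ x₀ r f hϱ hϱ0 hϱM hr hcϱ hf
  have hfc := hf.continuous
  have hc : Continuous (fderiv ℝ f) := hf.continuous_fderiv (by simp)
  have hmass : ENNReal.ofReal c₀ ≤ ∫⁻ x in Metric.ball x₀ r, ENNReal.ofReal (ϱ x) := by
    refine (ENNReal.ofReal_le_ofReal hcϱ).trans ?_
    rw [integral_eq_lintegral_of_nonneg_ae (Filter.Eventually.of_forall hϱ0)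
      hϱ.aestronglyMeasurable]
    exact ENNReal.ofReal_toReal_le
  have H' := H ϱ x₀ r f hϱ hϱM hr hmass hf
  have hN : ∫⁻ x in Metric.ball x₀ r, ‖fderiv ℝ f x‖ₑ ^ 2 =
      ENNReal.ofReal (∫ x in Metric.ball x₀ r, ‖gradient f x‖ ^ 2) := by
    simp only [aux_norm_gradient]
    rw [ofReal_integral_eq_lintegral_ofReal (aux_intOn _ (by fun_prop) x₀ r)
      (Filter.Eventually.of_forall fun x => by positivity)]
    congr 1; ext x
    rw [ENNReal.ofReal_pow (norm_nonneg _), ofReal_norm]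
  have hsq : ∀ x, (Real.sqrt (ϱ x) * f x) ^ 2 = ϱ x * f x ^ 2 := fun x => by
    rw [mul_pow, Real.sq_sqrt (hϱ0 x)]
  have hWint : IntegrableOn (fun x => ϱ x * f x ^ 2) (Metric.ball x₀ r) := by
    refine Integrable.bdd_mul (c := M) (aux_intOn _ (by fun_prop) x₀ r) hϱ.aestronglyMeasurable
      (Filter.Eventually.of_forall fun x => ?_)
    rw [Real.norm_of_nonneg (hϱ0 x)]; exact hϱM x
  have hW : ∫⁻ x in Metric.ball x₀ r, ENNReal.ofReal (ϱ x) * ‖f x‖ₑ ^ 2 =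
      ENNReal.ofReal (∫ x in Metric.ball x₀ r, (Real.sqrt (ϱ x) * f x) ^ 2) := by
    simp only [hsq]
    rw [ofReal_integral_eq_lintegral_ofReal hWint
      (Filter.Eventually.of_forall fun x => mul_nonneg (hϱ0 x) (sq_nonneg _))]
    congr 1; ext x
    rw [ENNReal.ofReal_mul (hϱ0 x), ← sq_abs, ENNReal.ofReal_pow (abs_nonneg _),
      ← Real.norm_eq_abs, ofReal_norm]
  have hI : ∫⁻ x in Metric.ball x₀ r, ‖f x‖ₑ ^ p =
      ENNReal.ofReal (∫ x in Metric.ball x₀ r, |f x| ^ p) := by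
    rw [ofReal_integral_eq_lintegral_ofReal (aux_intOn _
      (hfc.abs.rpow_const fun x => Or.inr hp0.le) x₀ r)
      (Filter.Eventually.of_forall fun x => by positivity)]
    congr 1; ext x
    rw [← ENNReal.ofReal_rpow_of_nonneg (abs_nonneg _) hp0.le, ← Real.norm_eq_abs, ofReal_norm]
  have hN0 : 0 ≤ ∫ x in Metric.ball x₀ r, ‖gradient f x‖ ^ 2 :=
    integral_nonneg fun x => by positivity
  have hW0 : 0 ≤ ∫ x in Metric.ball x₀ r, (Real.sqrt (ϱ x) * f x) ^ 2 :=
    integral_nonneg fun x => by positivity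
  have hI0 : 0 ≤ ∫ x in Metric.ball x₀ r, |f x| ^ p :=
    integral_nonneg fun x => by positivity
  rw [hN, hW, hI] at H'
  set N := ∫ x in Metric.ball x₀ r, ‖gradient f x‖ ^ 2
  set W := ∫ x in Metric.ball x₀ r, (Real.sqrt (ϱ x) * f x) ^ 2
  set I := ∫ x in Metric.ball x₀ r, |f x| ^ p
  set K := C.toReal with hK
  have hK0 : 0 ≤ K := ENNReal.toReal_nonneg
  rw [← ENNReal.ofReal_toReal hC, ← hK, ← ENNReal.ofReal_pow hr.le,
    ← ENNReal.ofReal_mul (by positivity), ← ENNReal.ofReal_mul (by positivity),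
    ← ENNReal.ofReal_add (by positivity) hW0,
    ENNReal.ofReal_rpow_of_nonneg (by positivity) (by positivity),
    ← ENNReal.ofReal_mul (by positivity), ENNReal.ofReal_le_ofReal_iff (by positivity)] at H'
  have h1 := Real.rpow_le_rpow hI0 H' (show 0 ≤ 1 / p by positivity)
  rw [Real.mul_rpow (by positivity) (by positivity), Real.mul_rpow hK0 (by positivity),
    ← Real.rpow_mul (by positivity), show p / 2 * (1 / p) = 1 / 2 by field_simp,
    ← Real.sqrt_eq_rpow, ← Real.rpow_natCast_mul hr.le,
    show ((2 : ℕ) : ℝ) * (1 / p) = 2 / p by push_cast; ring] at h1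
  refine h1.trans ?_
  have h2 : Real.sqrt (r ^ 2 * N + W) ≤ (1 + r) * Real.sqrt N + Real.sqrt W := by
    have hn := Real.sqrt_nonneg N
    have hw := Real.sqrt_nonneg W
    refine Real.sqrt_le_iff.2 ⟨by positivity, ?_⟩
    have e1 := Real.sq_sqrt hN0
    have e2 := Real.sq_sqrt hW0
    have : 0 ≤ (1 + r) * Real.sqrt N * Real.sqrt W := by positivity
    have : 0 ≤ r * N := by positivity
    nlinarith
  gcongr
  linarith
end

section
/- Let ρ ∈ L^∞(ℝ²) with 0 ≤ ρ ≤ ρ^M, and suppose ∫_{ℝ²} (1+|x|²) ρ(x) dx ≤ K for some K>0 and ∫_{B(0,1)} ρ(x) dx ≥ c₀ for some c₀>0. Then for every p ∈ [2,∞) there exists a constant C>0, depending only on p, ρ^M, K and c₀, such that for every continuously differentiable f:ℝ²→ℝ with ∇f ∈ L²(ℝ²) and f ∈ L²(B(0,1)), one has C^{-1} ‖√ρ f‖_{L^p(ℝ²)} ≤ ‖f‖_{L²(B(0,1))} + ‖∇f‖_{L²(ℝ²)} ≤ C ( ‖√ρ f‖_{L²(ℝ²)} + ‖∇f‖_{L²(ℝ²)}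 ). -/
open MeasureTheory

open scoped ENNReal NNReal

lemma lint_smul (G : E2 → ℝ≥0∞) (hG : Measurable G) {r : ℝ} (hr : 0 < r) :
    ∫⁻ x, G (r • x) = ENNReal.ofReal ((r ^ 2)⁻¹) * ∫⁻ x, G x := by
  have h := Measure.map_addHaar_smul (volume : Measure E2) hr.ne'
  have h2 : ∫⁻ x, G (r • x) = ∫⁻ x, G x ∂(Measure.map (r • ·) (volume : Measure E2)) := by
    rw [lintegral_map hG (measurable_const_smul r)]
  rw [h2, h, lintegral_smul_measure]
  simp [abs_of_pos hr]

lemma lint_affine (G : E2 → ℝ≥0∞) (hG : Measurable G) {r : ℝ} (hr : 1 / 2 ≤ r) (y : E2) :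
    ∫⁻ x, G (y + r • x) ≤ 4 * ∫⁻ x, G x := by
  rw [lint_smul (fun x => G (y + x)) (by fun_prop) (by linarith : 0 < r),
    lintegral_add_left_eq_self]
  gcongr
  rw [ENNReal.ofReal_le_iff_le_toReal (by simp)]
  simp only [ENNReal.toReal_ofNat]
  rw [inv_le_comm₀ (by nlinarith) (by norm_num)]
  nlinarith

lemma eLpNorm_two_sq {α F : Type*} [MeasurableSpace α] [NormedAddCommGroup F] (μ : Measure α)
    (f : α → F) : eLpNorm f 2 μ ^ 2 = ∫⁻ x, ‖f x‖ₑ ^ 2 ∂μ := by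
  have := eLpNorm_nnreal_pow_eq_lintegral (μ := μ) (f := f) (p := 2) two_ne_zero
  simpa using this

lemma seg_bound (g : E2 → ℝ) (hg : ContDiff ℝ 1 g) (x y : E2) :
    ‖g x - g y‖ₑ ^ 2 ≤
      ‖x - y‖ₑ ^ 2 * ∫⁻ t in Set.Ioc (0 : ℝ) 1, ‖fderiv ℝ g ((1 - t) • y + t • x)‖ₑ ^ 2 := by
  have hc : Continuous (fderiv ℝ g) := hg.continuous_fderiv one_ne_zero
  have hγ : Continuous (fun t : ℝ => fderiv ℝ g ((1 - t) • y + t • x)) := by fun_prop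
  have hd : ∀ t : ℝ, HasDerivAt (fun t : ℝ => g ((1 - t) • y + t • x))
      (fderiv ℝ g ((1 - t) • y + t • x) (x - y)) t := by
    intro t
    have h1 : HasDerivAt (fun t : ℝ => (1 - t) • y + t • x) (x - y) t := by
      have := (((hasDerivAt_id t).const_sub 1).smul_const y).add ((hasDerivAt_id t).smul_const x)
      have e : x - y = -(1:ℝ) • y + (1:ℝ) • x := by
        rw [one_smul, neg_smul, one_smul]; abel
      rw [e]
      exact this
    exact ((hg.differentiable one_ne_zero) _).hasFDerivAt.comp_hasDerivAt t h1
  have hint : ∫ t in (0:ℝ)..1, fderiv ℝ g ((1 - t) • y + t • x) (x - y) = g x - g y := by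
    rw [intervalIntegral.integral_eq_sub_of_hasDerivAt (fun t _ => hd t)
      ((hγ.clm_apply continuous_const).intervalIntegrable _ _)]
    simp
  rw [← hint, intervalIntegral.integral_of_le zero_le_one]
  have h1 : ‖∫ t in Set.Ioc (0:ℝ) 1, fderiv ℝ g ((1 - t) • y + t • x) (x - y)‖ₑ ≤
      ‖x - y‖ₑ * ∫⁻ t in Set.Ioc (0 : ℝ) 1, ‖fderiv ℝ g ((1 - t) • y + t • x)‖ₑ := by
    refine (enorm_integral_le_lintegral_enorm _).trans ?_
    rw [← lintegral_const_mul _ (by fun_prop)]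
    refine lintegral_mono fun t => ?_
    rw [mul_comm]
    exact ContinuousLinearMap.le_opENorm _ _
  refine (pow_le_pow_left' h1 2).trans ?_
  rw [mul_pow]
  gcongr
  have : IsProbabilityMeasure (volume.restrict (Set.Ioc (0:ℝ) 1)) := ⟨by simp⟩
  have h2 := eLpNorm_le_eLpNorm_of_exponent_le (μ := volume.restrict (Set.Ioc (0:ℝ) 1))
    (p := 1) (q := 2) (f := fun t : ℝ => fderiv ℝ g ((1 - t) • y + t • x)) (by norm_num)
    hγ.aestronglyMeasurable
  rw [eLpNorm_one_eq_lintegral_enorm] at h2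
  rw [← eLpNorm_two_sq]
  gcongr

lemma poincare_double (g : E2 → ℝ) (hg : ContDiff ℝ 1 g) :
    ∫⁻ y in Metric.ball (0:E2) 2, ∫⁻ x in Metric.ball (0:E2) 2, ‖g x - g y‖ₑ ^ 2 ≤
      64 * volume (Metric.ball (0:E2) 2) * ∫⁻ z, ‖fderiv ℝ g z‖ₑ ^ 2 := by
  have hc : Continuous (fderiv ℝ g) := hg.continuous_fderiv one_ne_zero
  set B := Metric.ball (0:E2) 2 with hB
  set G : E2 → ℝ≥0∞ := fun z => ‖fderiv ℝ g z‖ₑ ^ 2 with hGdef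
  have hG : Measurable G := by
    have : Continuous G := by fun_prop
    exact this.measurable
  have hBm : MeasurableSet B := Metric.isOpen_ball.measurableSet
  have key : ∀ t ∈ Set.Ioc (0:ℝ) 1, ∫⁻ y in B, ∫⁻ x in B, G ((1 - t) • y + t • x)
      ≤ volume B * (4 * ∫⁻ z, G z) := by
    intro t ht
    rcases le_total (1/2) t with h | h
    · calc _ ≤ ∫⁻ y in B, (4 * ∫⁻ z, G z) := by
            refine lintegral_mono fun y => (setLIntegral_le_lintegral _ _).trans ?_
            exact lint_affine G hG h _
        _ = _ := by simp [mul_comm]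
    · rw [lintegral_lintegral_swap (by
        apply Measurable.aemeasurable
        exact hG.comp (by fun_prop))]
      calc _ ≤ ∫⁻ y in B, (4 * ∫⁻ z, G z) := by
            refine lintegral_mono fun y => (setLIntegral_le_lintegral _ _).trans ?_
            have := lint_affine G hG (r := 1 - t) (by linarith) (t • y)
            simpa only [add_comm] using this
        _ = _ := by simp [mul_comm]
  calc _ ≤ ∫⁻ y in B, ∫⁻ x in B, 16 * ∫⁻ t in Set.Ioc (0:ℝ) 1, G ((1 - t) • y + t • x) := by
        refine setLIntegral_mono' hBm fun y hy => setLIntegral_mono' hBm fun x hx => ?_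
        refine (seg_bound g hg x y).trans ?_
        gcongr
        have : ‖x - y‖ ≤ 4 := by
          simp only [hB, mem_ball_zero_iff] at hx hy
          exact (norm_sub_le _ _).trans (by linarith)
        calc ‖x - y‖ₑ ^ 2 ≤ (4 : ℝ≥0∞) ^ 2 := by
              gcongr
              rw [← ofReal_norm]
              exact ENNReal.ofReal_le_of_le_toReal (by simpa using this)
          _ = 16 := by norm_num
    _ = 16 * ∫⁻ t in Set.Ioc (0:ℝ) 1, ∫⁻ y in B, ∫⁻ x in B, G ((1 - t) • y + t • x) := by
        have m3 : Measurable (fun z : (E2 × E2) × ℝ => G ((1 - z.2) • z.1.1 + z.2 • z.1.2)) :=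
          hG.comp (by fun_prop)
        have m4 : Measurable (fun z : (E2 × ℝ) × E2 => G ((1 - z.1.2) • z.1.1 + z.1.2 • z.2)) :=
          hG.comp (by fun_prop)
        have e1 : ∀ y : E2, ∫⁻ x in B, 16 * ∫⁻ t in Set.Ioc (0:ℝ) 1, G ((1 - t) • y + t • x)
            = 16 * ∫⁻ t in Set.Ioc (0:ℝ) 1, ∫⁻ x in B, G ((1 - t) • y + t • x) := by
          intro y
          rw [lintegral_const_mul' _ _ (by simp), lintegral_lintegral_swap]
          apply Measurable.aemeasurable
          exact hG.comp (by fun_prop)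
        simp_rw [e1]
        rw [lintegral_const_mul' _ _ (by simp), lintegral_lintegral_swap]
        apply Measurable.aemeasurable
        exact m4.lintegral_prod_right'
    _ ≤ 16 * ∫⁻ t in Set.Ioc (0:ℝ) 1, volume B * (4 * ∫⁻ z, G z) := by
        gcongr 1
        exact setLIntegral_mono' measurableSet_Ioc key
    _ = _ := by
        simp only [lintegral_const, MeasurableSet.univ, Measure.restrict_apply, Set.univ_inter,
          Real.volume_Ioc]
        norm_num
        rw [show (64 : ℝ≥0∞) = 16 * 4 by norm_num]
        ring

lemma poincare_sobolev (q : ℝ≥0) (hq : 2 ≤ q) : ∃ C : ℝ≥0, ∀ g : E2 → ℝ, ContDiff ℝ 1 g →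
    ∃ m : ℝ, eLpNorm (fun x => g x - m) q (volume.restrict (Metric.ball (0:E2) 1)) ≤
      C * eLpNorm (fderiv ℝ g) 2 volume := by
  set B := Metric.ball (0:E2) 2 with hB
  have hBm : MeasurableSet B := Metric.isOpen_ball.measurableSet
  have hB0 : volume B ≠ 0 := (Metric.measure_ball_pos _ _ (by norm_num)).ne'
  have hBt : volume B ≠ ∞ := measure_ball_lt_top.ne
  let φ : ContDiffBump (0:E2) := ⟨1, 3/2, by norm_num, by norm_num⟩
  have hφ1 : ContDiff ℝ 1 φ := φ.contDiff
  obtain ⟨L, hL⟩ : ∃ L, ∀ x, ‖fderiv ℝ φ x‖ ≤ L :=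
    (φ.hasCompactSupport.fderiv (𝕜 := ℝ)).exists_bound_of_continuous
      (hφ1.continuous_fderiv one_ne_zero)
  have hL0 : 0 ≤ L := (norm_nonneg _).trans (hL 0)
  have hq0 : (0:ℝ) < q := by
    have : (2:ℝ) ≤ q := by exact_mod_cast hq
    linarith
  have hqi : (q:ℝ)⁻¹ ≤ 1/2 := by
    have : (2:ℝ) ≤ q := by exact_mod_cast hq
    rw [inv_le_comm₀ hq0 (by norm_num)]; simpa using this
  let p : ℝ≥0 := (1/2 + q⁻¹)⁻¹
  have hpinv : (p:ℝ)⁻¹ = 1/2 + (q:ℝ)⁻¹ := by simp [p]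
  have hp0 : (0:ℝ) < p := by
    rw [← inv_pos, hpinv]; positivity
  have hp1 : 1 ≤ p := by
    have : (1:ℝ) ≤ p := by
      rw [← inv_le_one₀ hp0, hpinv]; linarith
    exact_mod_cast this
  have hp2 : p < 2 := by
    have : (p:ℝ) < 2 := by
      rw [← inv_lt_inv₀ (by norm_num) hp0, hpinv]
      have : 0 < (q:ℝ)⁻¹ := by positivity
      linarith
    exact_mod_cast this
  let C1 : ℝ≥0 := eLpNormLESNormFDerivOfLeConst ℝ (volume : Measure E2) B p q
  let e : ℝ := 1 / (p : ℝ≥0∞).toReal - 1 / (2 : ℝ≥0∞).toReal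
  have he : 0 ≤ e := by
    simp only [e, ENNReal.coe_toReal, ENNReal.toReal_ofNat, one_div, hpinv]
    have : 0 < (q:ℝ)⁻¹ := by positivity
    linarith
  have hC2 : volume B ^ e ≠ ∞ := ENNReal.rpow_ne_top_of_nonneg he hBt
  refine ⟨C1 * ((1 + L.toNNReal * 8) * (volume B ^ e).toNNReal), fun g hg => ?_⟩
  have hcg : Continuous (fderiv ℝ g) := hg.continuous_fderiv one_ne_zero
  have hgc := hg.continuous
  set D := eLpNorm (fderiv ℝ g) 2 volume with hD
  -- choose m
  obtain ⟨y, hy, hym⟩ := exists_le_setLAverage (μ := volume) (s := B) hB0 hBt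
    (f := fun y => ∫⁻ x in B, ‖g x - g y‖ₑ ^ 2) (by
      apply Measurable.aemeasurable
      apply Measurable.lintegral_prod_right' (f := fun z : E2 × E2 => ‖g z.2 - g z.1‖ₑ ^ 2)
      fun_prop)
  have hm : eLpNorm (fun x => g x - g y) 2 (volume.restrict B) ≤ 8 * D := by
    have h1 : eLpNorm (fun x => g x - g y) 2 (volume.restrict B) ^ 2 ≤ (8 * D) ^ 2 := by
      rw [eLpNorm_two_sq]
      refine hym.trans ?_
      rw [setLAverage_eq]
      refine ENNReal.div_le_of_le_mul ((poincare_double g hg).trans (le_of_eq ?_))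
      rw [mul_pow, hD, eLpNorm_two_sq]
      rw [show (8:ℝ≥0∞) ^ 2 = 64 by norm_num]
      ring
    exact (ENNReal.pow_le_pow_left_iff two_ne_zero).1 h1
  refine ⟨g y, ?_⟩
  set m := g y
  let u : E2 → ℝ := fun x => φ x * (g x - m)
  have hu : ContDiff ℝ 1 u := hφ1.mul (hg.sub contDiff_const)
  have hts : tsupport u ⊆ B := by
    refine (tsupport_mul_subset_left).trans ?_
    rw [φ.tsupport_eq]
    exact Metric.closedBall_subset_ball (by norm_num : (3/2:ℝ) < 2)
  have hsob : eLpNorm u q volume ≤ C1 * eLpNorm (fderiv ℝ u) p volume := by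
    apply eLpNorm_le_eLpNorm_fderiv_of_le volume hu ((subset_tsupport u).trans hts) hp1
    · simpa using hp2
    · simp [hpinv]
    · exact Metric.isBounded_ball
  have hdu : ∀ x, ‖fderiv ℝ u x‖ ≤ ‖fderiv ℝ g x‖ + L * ‖g x - m‖ := by
    intro x
    have h1 : fderiv ℝ u x = φ x • fderiv ℝ g x + (g x - m) • fderiv ℝ φ x := by
      have := ((hφ1.differentiable one_ne_zero) x).hasFDerivAt.mul
        (((hg.differentiable one_ne_zero) x).hasFDerivAt.sub_const m)
      exact this.fderiv
    rw [h1]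
    refine (norm_add_le _ _).trans ?_
    rw [norm_smul, norm_smul, mul_comm L]
    gcongr
    · rw [Real.norm_of_nonneg φ.nonneg]
      exact mul_le_of_le_one_left (norm_nonneg _) φ.le_one
    · exact hL x
  have h2 : eLpNorm (fderiv ℝ u) 2 (volume.restrict B) ≤ (1 + ENNReal.ofReal L * 8) * D := by
    calc _ ≤ eLpNorm (fun x => ‖fderiv ℝ g x‖ + L * ‖g x - m‖) 2 (volume.restrict B) :=
          eLpNorm_mono_real hdu
      _ ≤ eLpNorm (fun x => ‖fderiv ℝ g x‖) 2 (volume.restrict B)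
          + eLpNorm (fun x => L * ‖g x - m‖) 2 (volume.restrict B) := by
          apply eLpNorm_add_le
          · exact hcg.norm.aestronglyMeasurable
          · exact (by fun_prop : Continuous (fun x => L * ‖g x - m‖)).aestronglyMeasurable
          · norm_num
      _ ≤ D + ENNReal.ofReal L * (8 * D) := by
          gcongr
          · rw [eLpNorm_norm]
            exact eLpNorm_mono_measure _ Measure.restrict_le_self
          · have := eLpNorm_const_smul (μ := volume.restrict B) (p := 2) L (fun x => ‖g x - m‖)
            have h3 : (fun x => L * ‖g x - m‖) = L • (fun x => ‖g x - m‖) := rfl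
            rw [h3, this, eLpNorm_norm, Real.enorm_eq_ofReal hL0]
            gcongr
      _ = _ := by ring
  have h3 : eLpNorm (fderiv ℝ u) p volume ≤ (1 + ENNReal.ofReal L * 8) * D * volume B ^ e := by
    have hs : Function.support (fderiv ℝ u) ⊆ B := (support_fderiv_subset ℝ).trans hts
    rw [← eLpNorm_restrict_eq_of_support_subset (f := fderiv ℝ u) (s := B) hs]
    have := eLpNorm_le_eLpNorm_mul_rpow_measure_univ (μ := volume.restrict B)
      (p := p) (q := 2) (f := fderiv ℝ u) (by exact_mod_cast hp2.le)
      (hu.continuous_fderiv one_ne_zero).aestronglyMeasurable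
    refine this.trans ?_
    rw [Measure.restrict_apply_univ]
    gcongr
  calc _ = eLpNorm u q (volume.restrict (Metric.ball (0:E2) 1)) := by
        apply eLpNorm_congr_ae
        refine (ae_restrict_iff' Metric.isOpen_ball.measurableSet).2 (Filter.Eventually.of_forall ?_)
        intro x hx
        have : φ x = 1 := φ.one_of_mem_closedBall (Metric.ball_subset_closedBall hx)
        simp [u, this]
    _ ≤ eLpNorm u q volume := eLpNorm_mono_measure _ Measure.restrict_le_self
    _ ≤ C1 * ((1 + ENNReal.ofReal L * 8) * D * volume B ^ e) := hsob.trans (by gcongr)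
    _ = _ := by
        push_cast
        rw [ENNReal.coe_toNNReal hC2]
        simp only [ENNReal.ofReal]
        ring

lemma energy_scale (g : E2 → ℝ) (hg : ContDiff ℝ 1 g) {r : ℝ} (hr : 0 < r) :
    eLpNorm (fderiv ℝ (fun x => g (r • x))) 2 volume = eLpNorm (fderiv ℝ g) 2 volume := by
  have hc : Continuous (fderiv ℝ g) := hg.continuous_fderiv one_ne_zero
  have h1 : eLpNorm (fderiv ℝ (fun x => g (r • x))) 2 volume ^ 2
      = eLpNorm (fderiv ℝ g) 2 volume ^ 2 := by
    rw [eLpNorm_two_sq, eLpNorm_two_sq]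
    have h2 : ∀ x, ‖fderiv ℝ (fun x => g (r • x)) x‖ₑ ^ 2
        = ENNReal.ofReal (r ^ 2) * ‖fderiv ℝ g (r • x)‖ₑ ^ 2 := by
      intro x
      rw [fderiv_comp_smul, enorm_smul, mul_pow, Real.enorm_eq_ofReal hr.le,
        ENNReal.ofReal_pow hr.le]
    simp_rw [h2]
    rw [lintegral_const_mul' _ _ (by simp),
      lint_smul (fun x => ‖fderiv ℝ g x‖ₑ ^ 2) (by fun_prop) hr, ← mul_assoc,
      ← ENNReal.ofReal_mul (by positivity), mul_inv_cancel₀ (by positivity)]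
    simp
  exact le_antisymm ((ENNReal.pow_le_pow_left_iff two_ne_zero).1 h1.le)
    ((ENNReal.pow_le_pow_left_iff two_ne_zero).1 h1.ge)

lemma lint_ball_scale (G : E2 → ℝ≥0∞) (hG : Measurable G) {r : ℝ} (hr : 0 < r) (s : ℝ) :
    ∫⁻ x in Metric.ball (0:E2) (r * s), G x
      = ENNReal.ofReal (r ^ 2) * ∫⁻ x in Metric.ball (0:E2) s, G (r • x) := by
  rw [← lintegral_indicator Metric.isOpen_ball.measurableSet,
    ← lintegral_indicator Metric.isOpen_ball.measurableSet]
  have h := lint_smul ((Metric.ball (0:E2) (r * s)).indicator G)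
    (hG.indicator Metric.isOpen_ball.measurableSet) hr
  have h2 : ∀ x, (Metric.ball (0:E2) (r * s)).indicator G (r • x)
      = (Metric.ball (0:E2) s).indicator (fun x => G (r • x)) x := by
    intro x
    have : r • x ∈ Metric.ball (0:E2) (r * s) ↔ x ∈ Metric.ball (0:E2) s := by
      simp only [mem_ball_zero_iff, norm_smul, Real.norm_of_nonneg hr.le]
      exact mul_lt_mul_iff_right₀ hr
    by_cases hx : x ∈ Metric.ball (0:E2) s
    · rw [Set.indicator_of_mem hx, Set.indicator_of_mem (this.2 hx)]
    · rw [Set.indicator_of_notMem hx, Set.indicator_of_notMem (fun h => hx (this.1 h))]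
  simp_rw [h2] at h
  rw [h, ← mul_assoc, ← ENNReal.ofReal_mul (by positivity), mul_inv_cancel₀ (by positivity)]
  simp

lemma half_bound (q : ℝ≥0) (hq : 2 ≤ q) (g : E2 → ℝ) (hg : Continuous g) :
    eLpNorm g q (volume.restrict (Metric.ball (0:E2) 1)) ≤
      4 * eLpNorm (fun x => g ((2:ℝ) • x)) q (volume.restrict (Metric.ball (0:E2) 1)) := by
  have hq2 : (2:ℝ) ≤ q := by exact_mod_cast hq
  have hq0 : q ≠ 0 := by rintro rfl; norm_num at hq2
  rw [eLpNorm_nnreal_eq_lintegral hq0, eLpNorm_nnreal_eq_lintegral hq0]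
  have h := lint_ball_scale (fun x => ‖g x‖ₑ ^ (q:ℝ)) (by fun_prop) (r := 2) (by norm_num) (1/2)
  rw [show (2:ℝ) * (1/2) = 1 by norm_num] at h
  rw [h, ENNReal.mul_rpow_of_nonneg _ _ (by positivity)]
  gcongr
  · rw [show ENNReal.ofReal (2 ^ 2) = 4 by norm_num]
    calc (4:ℝ≥0∞) ^ (1 / (q:ℝ)) ≤ 4 ^ (1:ℝ) := by
          apply ENNReal.rpow_le_rpow_of_exponent_le (by norm_num)
          rw [div_le_one (by linarith)]; linarith
      _ = 4 := by simp
  · norm_num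

lemma step (q : ℝ≥0) (hq : 2 ≤ q) : ∃ C : ℝ≥0, ∀ g : E2 → ℝ, ContDiff ℝ 1 g →
    eLpNorm (fun x => g ((2:ℝ) • x)) q (volume.restrict (Metric.ball (0:E2) 1)) ≤
      eLpNorm g q (volume.restrict (Metric.ball (0:E2) 1)) +
      C * eLpNorm (fderiv ℝ g) 2 volume := by
  obtain ⟨C, hC⟩ := poincare_sobolev q hq
  have hq1 : (1:ℝ≥0∞) ≤ q := by exact_mod_cast (one_le_two.trans hq)
  refine ⟨5 * C, fun g hg => ?_⟩
  have hgc := hg.continuous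
  obtain ⟨m, hm⟩ := hC (fun x => g ((2:ℝ) • x)) (hg.comp (contDiff_const_smul _))
  rw [energy_scale g hg (by norm_num)] at hm
  set D := eLpNorm (fderiv ℝ g) 2 volume
  set μ := volume.restrict (Metric.ball (0:E2) 1)
  have h1 := half_bound q hq (fun x => g x - m) (by fun_prop)
  calc eLpNorm (fun x => g ((2:ℝ) • x)) q μ
      = eLpNorm ((fun x => g ((2:ℝ) • x) - m) + (fun x => m - g x) + g) q μ := by
        rw [show ((fun x => g ((2:ℝ) • x) - m) + (fun x => m - g x) + g)
          = fun x => g ((2:ℝ) • x) from by ext x; simp]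
    _ ≤ eLpNorm (fun x => g ((2:ℝ) • x) - m) q μ + eLpNorm (fun x => m - g x) q μ
          + eLpNorm g q μ := by
        refine (eLpNorm_add_le ?_ hgc.aestronglyMeasurable hq1).trans ?_
        · exact (by fun_prop : Continuous ((fun x => g ((2:ℝ) • x) - m) + (fun x => m - g x))).aestronglyMeasurable
        gcongr
        exact eLpNorm_add_le (by fun_prop : Continuous _).aestronglyMeasurable
          (by fun_prop : Continuous _).aestronglyMeasurable hq1
    _ ≤ C * D + 4 * (C * D) + eLpNorm g q μ := by
        gcongr
        rw [show (fun x => m - g x) = - (fun x => g x - m) from by ext x; simp, eLpNorm_neg]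
        exact h1.trans (by gcongr)
    _ = _ := by push_cast; ring

lemma base (q : ℝ≥0) (hq : 2 ≤ q) : ∃ C : ℝ≥0, ∀ g : E2 → ℝ, ContDiff ℝ 1 g →
    eLpNorm g q (volume.restrict (Metric.ball (0:E2) 1)) ≤
      C * (eLpNorm g 2 (volume.restrict (Metric.ball (0:E2) 1)) +
      eLpNorm (fderiv ℝ g) 2 volume) := by
  obtain ⟨C, hC⟩ := poincare_sobolev q hq
  have hq1 : (1:ℝ≥0∞) ≤ q := by exact_mod_cast (one_le_two.trans hq)
  have hq2 : (2:ℝ≥0∞) ≤ q := by exact_mod_cast hq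
  set μ := volume.restrict (Metric.ball (0:E2) 1) with hμ
  have hq0 : (q:ℝ≥0∞) ≠ 0 := fun h => by rw [h] at hq1; simp at hq1
  let V := volume (Metric.ball (0:E2) 1)
  have hV : μ Set.univ = V := by simp [hμ, V]
  have hV0 : V ≠ 0 := (Metric.measure_ball_pos _ _ (by norm_num)).ne'
  have hVt : V ≠ ∞ := measure_ball_lt_top.ne
  have hμ0 : μ ≠ 0 := by
    intro h; apply hV0; rw [← hV, h]; simp
  -- constants
  let c1 : ℝ≥0∞ := V ^ (1 / (2:ℝ≥0∞).toReal - 1 / (q:ℝ≥0∞).toReal)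
  have hc1 : c1 ≠ ∞ := ENNReal.rpow_ne_top_of_ne_zero hV0 hVt
  let c2 : ℝ≥0∞ := V ^ (1 / (q:ℝ≥0∞).toReal - 1 / (2:ℝ≥0∞).toReal)
  have hc2 : c2 ≠ ∞ := ENNReal.rpow_ne_top_of_ne_zero hV0 hVt
  refine ⟨C + c2.toNNReal * (1 + C * c1.toNNReal), fun g hg => ?_⟩
  have hgc := hg.continuous
  obtain ⟨m, hm⟩ := hC g hg
  set D := eLpNorm (fderiv ℝ g) 2 volume
  set A := eLpNorm g 2 μ
  have hconst : eLpNorm (fun _ : E2 => m) q μ = c2 * eLpNorm (fun _ : E2 => m) 2 μ := by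
    rw [eLpNorm_const _ hq0 hμ0, eLpNorm_const _ two_ne_zero hμ0, hV]
    simp only [c2]
    rw [ENNReal.rpow_sub _ _ hV0 hVt, mul_left_comm, ENNReal.div_mul_cancel]
    · simp [hV0, hVt]
    · exact ENNReal.rpow_ne_top_of_ne_zero hV0 hVt
  have hm2 : eLpNorm (fun x => g x - m) 2 μ ≤ C * D * c1 := by
    have := eLpNorm_le_eLpNorm_mul_rpow_measure_univ (μ := μ) (p := 2) (q := q)
      (f := fun x => g x - m) hq2 (by fun_prop : Continuous _).aestronglyMeasurable
    rw [hV] at this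
    exact this.trans (by gcongr)
  have hc : eLpNorm (fun _ : E2 => m) 2 μ ≤ A + C * D * c1 := by
    calc _ = eLpNorm (g - (fun x => g x - m)) 2 μ := by
          congr 1; ext x; simp
      _ ≤ A + eLpNorm (fun x => g x - m) 2 μ :=
          eLpNorm_sub_le hgc.aestronglyMeasurable (by fun_prop : Continuous _).aestronglyMeasurable
            (by norm_num)
      _ ≤ _ := by gcongr
  calc eLpNorm g q μ = eLpNorm ((fun x => g x - m) + (fun _ => m)) q μ := by
        congr 1; ext x; simp
    _ ≤ eLpNorm (fun x => g x - m) q μ + eLpNorm (fun _ : E2 => m) q μ :=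
        eLpNorm_add_le (by fun_prop : Continuous _).aestronglyMeasurable
          (by fun_prop : Continuous _).aestronglyMeasurable hq1
    _ ≤ C * D + c2 * (A + C * D * c1) := by
        rw [hconst]; gcongr
    _ ≤ C * D + c2 * (A + C * D * c1) + (C * A + c2 * (D + C * A * c1)) := le_self_add
    _ = _ := by
        push_cast
        rw [ENNReal.coe_toNNReal hc1, ENNReal.coe_toNNReal hc2]
        ring

lemma dyadic (q : ℝ≥0) (hq : 2 ≤ q) : ∃ C : ℝ≥0, ∀ g : E2 → ℝ, ContDiff ℝ 1 g → ∀ k : ℕ,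
    eLpNorm (fun x => g ((2:ℝ) ^ k • x)) q (volume.restrict (Metric.ball (0:E2) 1)) ≤
      C * (k + 1) * (eLpNorm g 2 (volume.restrict (Metric.ball (0:E2) 1)) +
      eLpNorm (fderiv ℝ g) 2 volume) := by
  obtain ⟨C1, h1⟩ := step q hq
  obtain ⟨C2, h2⟩ := base q hq
  refine ⟨C1 + C2, fun g hg k => ?_⟩
  induction k with
  | zero =>
    simp only [pow_zero, one_smul]
    refine (h2 g hg).trans ?_
    gcongr
    push_cast
    simp
  | succ k ih =>
    have h := h1 (fun x => g ((2:ℝ) ^ k • x)) (hg.comp (contDiff_const_smul _))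
    rw [energy_scale g hg (by positivity)] at h
    have e : (fun x : E2 => g ((2:ℝ) ^ (k+1) • x)) = fun x => g ((2:ℝ) ^ k • (2:ℝ) • x) := by
      ext x; rw [smul_smul, pow_succ]
    rw [e]
    refine h.trans ?_
    set D := eLpNorm (fderiv ℝ g) 2 volume
    set A := eLpNorm g 2 (volume.restrict (Metric.ball (0:E2) 1))
    calc _ ≤ ((C1 + C2 : ℝ≥0) : ℝ≥0∞) * (k + 1) * (A + D) + (C1 + C2 : ℝ≥0) * (A + D) := by
          gcongr
          · simp
          · simp
      _ = _ := by push_cast; ring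

noncomputable def wgt (x : E2) : ℝ≥0∞ := ENNReal.ofReal (1 + ‖x‖ ^ 2)

lemma wgt_ne_zero (x : E2) : wgt x ≠ 0 := by
  have : 0 < 1 + ‖x‖ ^ 2 := by positivity
  simpa [wgt] using this

lemma wgt_ne_top (x : E2) : wgt x ≠ ∞ := by simp [wgt]

lemma wgt_meas : Measurable wgt := by unfold wgt; fun_prop

lemma sum_fin (q : ℝ≥0) : ∑' k : ℕ, ENNReal.ofReal ((1/4) ^ k) * ((k:ℝ≥0∞) + 1) ^ (q:ℝ) ≠ ∞ := by
  obtain ⟨n, hn⟩ := exists_nat_ge (q:ℝ)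
  have hs : Summable (fun k : ℕ => (k:ℝ) ^ n * (1/4:ℝ) ^ k) :=
    summable_pow_mul_geometric_of_norm_lt_one n (by norm_num)
  have hs1 := ((summable_nat_add_iff 1).2 hs).mul_left 4
  have h := hs1.tsum_ofReal_ne_top
  refine ne_top_of_le_ne_top h (ENNReal.tsum_le_tsum fun k => ?_)
  have e : 4 * (((k+1 : ℕ):ℝ) ^ n * (1/4:ℝ) ^ (k+1)) = (1/4) ^ k * ((k:ℝ)+1) ^ n := by
    push_cast; ring
  rw [e, ENNReal.ofReal_mul (by positivity)]
  gcongr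
  rw [ENNReal.ofReal_pow (by positivity), ENNReal.ofReal_add (by positivity) (by norm_num)]
  simp only [ENNReal.ofReal_natCast, ENNReal.ofReal_one]
  rw [← ENNReal.rpow_natCast]
  exact ENNReal.rpow_le_rpow_of_exponent_le (by simp) hn

lemma wgt_pointwise (x : E2) (G : E2 → ℝ≥0∞) : G x * (wgt x)⁻¹ ^ 2 ≤
    ∑' k : ℕ, ENNReal.ofReal (16 * (1/16) ^ k) * (Metric.ball (0:E2) (2 ^ k)).indicator G x := by
  have hex : ∃ k : ℕ, ‖x‖ < 2 ^ k := pow_unbounded_of_one_lt _ one_lt_two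
  classical
  let k := Nat.find hex
  have hk : ‖x‖ < 2 ^ k := Nat.find_spec hex
  refine le_trans ?_ (ENNReal.le_tsum k)
  rw [Set.indicator_of_mem (by simpa using hk), mul_comm]
  gcongr
  have hreal : (1 + ‖x‖ ^ 2)⁻¹ ^ 2 ≤ 16 * (1/16:ℝ) ^ k := by
    rcases Nat.eq_zero_or_pos k with h0 | h0
    · rw [h0, inv_pow]
      have : ((1 + ‖x‖ ^ 2) ^ 2)⁻¹ ≤ 1 := inv_le_one_of_one_le₀ (one_le_pow₀ (by nlinarith [sq_nonneg ‖x‖]))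
      linarith
    · obtain ⟨j, hj⟩ : ∃ j, k = j + 1 := ⟨k - 1, by omega⟩
      have hjx : (2:ℝ) ^ j ≤ ‖x‖ := by
        by_contra hcon
        have := Nat.find_min hex (m := j) (by change j < k; omega)
        exact this (not_le.1 hcon)
      have h4 : (4:ℝ) ^ j ≤ 1 + ‖x‖ ^ 2 := by
        have : ((2:ℝ) ^ j) ^ 2 ≤ ‖x‖ ^ 2 := by gcongr
        rw [← pow_mul, mul_comm j 2, pow_mul] at this
        norm_num at this
        linarith
      calc (1 + ‖x‖ ^ 2)⁻¹ ^ 2 ≤ ((4:ℝ) ^ j)⁻¹ ^ 2 := by gcongr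
        _ = 16 * (1/16:ℝ) ^ k := by
          rw [hj, pow_succ (1/16:ℝ), ← inv_pow, ← pow_mul, mul_comm j 2, pow_mul]
          norm_num
          try ring
  have : (wgt x)⁻¹ ^ 2 = ENNReal.ofReal ((1 + ‖x‖ ^ 2)⁻¹ ^ 2) := by
    rw [wgt, ENNReal.ofReal_pow (by positivity), ENNReal.ofReal_inv_of_pos (by positivity)]
  rw [this]
  exact ENNReal.ofReal_le_ofReal hreal

lemma weighted (q : ℝ≥0) (hq : 2 ≤ q) : ∃ C : ℝ≥0, ∀ g : E2 → ℝ, ContDiff ℝ 1 g →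
    ∫⁻ x, ‖g x‖ₑ ^ (q:ℝ) * (wgt x)⁻¹ ^ 2 ≤
      C * (eLpNorm g 2 (volume.restrict (Metric.ball (0:E2) 1)) +
      eLpNorm (fderiv ℝ g) 2 volume) ^ (q:ℝ) := by
  obtain ⟨C, hC⟩ := dyadic q hq
  have hq2 : (2:ℝ) ≤ q := by exact_mod_cast hq
  have hq0 : q ≠ 0 := by rintro rfl; norm_num at hq2
  set S := ∑' k : ℕ, ENNReal.ofReal ((1/4) ^ k) * ((k:ℝ≥0∞) + 1) ^ (q:ℝ) with hS
  have hSt : S ≠ ∞ := sum_fin q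
  refine ⟨(16 * (C:ℝ≥0∞) ^ (q:ℝ) * S).toNNReal, fun g hg => ?_⟩
  rw [ENNReal.coe_toNNReal (ENNReal.mul_ne_top (ENNReal.mul_ne_top (by simp)
    (ENNReal.rpow_ne_top_of_nonneg (by positivity) (by simp))) hSt)]
  have hgc := hg.continuous
  set M := (eLpNorm g 2 (volume.restrict (Metric.ball (0:E2) 1)) +
      eLpNorm (fderiv ℝ g) 2 volume)
  have hGm : Measurable (fun x => ‖g x‖ₑ ^ (q:ℝ)) := by fun_prop
  calc _ ≤ ∫⁻ x, ∑' k : ℕ, ENNReal.ofReal (16 * (1/16) ^ k) *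
          (Metric.ball (0:E2) (2 ^ k)).indicator (fun x => ‖g x‖ₑ ^ (q:ℝ)) x :=
        lintegral_mono fun x => wgt_pointwise x (fun x => ‖g x‖ₑ ^ (q:ℝ))
    _ = ∑' k : ℕ, ENNReal.ofReal (16 * (1/16) ^ k) *
          ∫⁻ x in Metric.ball (0:E2) (2 ^ k), ‖g x‖ₑ ^ (q:ℝ) := by
        rw [lintegral_tsum]
        · congr 1; ext k
          rw [lintegral_const_mul' _ _ ENNReal.ofReal_ne_top, lintegral_indicator Metric.isOpen_ball.measurableSet]
        · intro k
          exact ((hGm.indicator Metric.isOpen_ball.measurableSet).const_mul _).aemeasurable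
    _ ≤ ∑' k : ℕ, (16 * (C:ℝ≥0∞) ^ (q:ℝ) * M ^ (q:ℝ)) *
          (ENNReal.ofReal ((1/4) ^ k) * ((k:ℝ≥0∞) + 1) ^ (q:ℝ)) := by
        refine ENNReal.tsum_le_tsum fun k => ?_
        have h1 := lint_ball_scale (fun x => ‖g x‖ₑ ^ (q:ℝ)) hGm (r := 2 ^ k) (by positivity) 1
        rw [mul_one] at h1
        have h2 : ∫⁻ x in Metric.ball (0:E2) 1, ‖g ((2:ℝ) ^ k • x)‖ₑ ^ (q:ℝ)
            ≤ (C * (k + 1) * M) ^ (q:ℝ) := by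
          rw [← eLpNorm_nnreal_pow_eq_lintegral hq0]
          gcongr
          exact hC g hg k
        rw [h1]
        calc _ ≤ ENNReal.ofReal (16 * (1/16) ^ k) * (ENNReal.ofReal ((2 ^ k) ^ 2) *
              (C * (k + 1) * M) ^ (q:ℝ)) := by gcongr
          _ = (ENNReal.ofReal (16 * (1/16) ^ k) * ENNReal.ofReal ((2 ^ k) ^ 2)) *
              ((C:ℝ≥0∞) ^ (q:ℝ) * (k + 1) ^ (q:ℝ) * M ^ (q:ℝ)) := by
              rw [ENNReal.mul_rpow_of_nonneg _ _ (by positivity),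
                ENNReal.mul_rpow_of_nonneg _ _ (by positivity)]
              ring
          _ = _ := by
              have e : ENNReal.ofReal (16 * (1/16) ^ k) * ENNReal.ofReal ((2 ^ k) ^ 2)
                  = 16 * ENNReal.ofReal ((1/4) ^ k) := by
                rw [← ENNReal.ofReal_mul (by positivity)]
                rw [show (16:ℝ) * (1/16) ^ k * (2 ^ k) ^ 2 = 16 * (1/4) ^ k by
                  rw [← pow_mul, mul_comm k 2, pow_mul, mul_assoc, ← mul_pow]; norm_num]
                rw [ENNReal.ofReal_mul (by norm_num)]
                norm_num
              rw [e]; ring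
    _ = _ := by
        rw [ENNReal.tsum_mul_left, ← hS]; ring

lemma upper (p : ℝ≥0) (hp : 2 ≤ p) (ρM K : ℝ) : ∃ C : ℝ≥0, ∀ ρ f : E2 → ℝ,
    Measurable ρ → (∀ x, 0 ≤ ρ x) → (∀ x, ρ x ≤ ρM) →
    (∫⁻ x, wgt x * ENNReal.ofReal (ρ x)) ≤ ENNReal.ofReal K →
    ContDiff ℝ 1 f →
    eLpNorm (fun x => Real.sqrt (ρ x) * f x) p volume ≤
      C * (eLpNorm f 2 (volume.restrict (Metric.ball (0:E2) 1)) +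
      eLpNorm (fderiv ℝ f) 2 volume) := by
  have hp2 : (2:ℝ) ≤ p := by exact_mod_cast hp
  have hp0 : p ≠ 0 := by rintro rfl; norm_num at hp2
  obtain ⟨C, hC⟩ := weighted (3 * p) (hp.trans (by
    have : (p:ℝ) ≤ 3 * p := by linarith
    exact_mod_cast this))
  set R := ENNReal.ofReal ρM with hR
  let c : ℝ≥0∞ := R ^ ((p:ℝ) / 2 - 1) *
    ((R ^ (1/2 : ℝ) * ENNReal.ofReal K) ^ (2/3:ℝ) * (C:ℝ≥0∞) ^ (1/3:ℝ))
  have hc : c ^ (1 / (p:ℝ)) ≠ ∞ := by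
    refine ENNReal.rpow_ne_top_of_nonneg (by positivity) ?_
    refine ENNReal.mul_ne_top (ENNReal.rpow_ne_top_of_nonneg (by linarith) (by simp [hR])) ?_
    refine ENNReal.mul_ne_top (ENNReal.rpow_ne_top_of_nonneg (by norm_num) ?_)
      (ENNReal.rpow_ne_top_of_nonneg (by norm_num) (by simp))
    exact ENNReal.mul_ne_top (ENNReal.rpow_ne_top_of_nonneg (by norm_num) (by simp [hR])) (by simp)
  refine ⟨(c ^ (1 / (p:ℝ))).toNNReal, fun ρ f hρ h0 hM hK hf => ?_⟩
  have hfc := hf.continuous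
  have hwm := wgt_meas
  set M := (eLpNorm f 2 (volume.restrict (Metric.ball (0:E2) 1)) +
      eLpNorm (fderiv ℝ f) 2 volume)
  rw [ENNReal.coe_toNNReal hc, eLpNorm_nnreal_eq_lintegral hp0]
  have hrR : ∀ x, ENNReal.ofReal (ρ x) ≤ R := fun x => ENNReal.ofReal_le_ofReal (hM x)
  have hpt : ∀ x, ‖Real.sqrt (ρ x) * f x‖ₑ ^ (p:ℝ) ≤
      R ^ ((p:ℝ) / 2 - 1) * (ENNReal.ofReal (ρ x) * ‖f x‖ₑ ^ (p:ℝ)) := by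
    intro x
    rw [enorm_mul, ENNReal.mul_rpow_of_nonneg _ _ (by positivity),
      Real.enorm_eq_ofReal (Real.sqrt_nonneg _), Real.sqrt_eq_rpow,
      ← ENNReal.ofReal_rpow_of_nonneg (h0 x) (by norm_num), ← ENNReal.rpow_mul, ← mul_assoc]
    gcongr
    calc ENNReal.ofReal (ρ x) ^ (1 / 2 * (p:ℝ))
        = ENNReal.ofReal (ρ x) ^ ((p:ℝ)/2 - 1) * ENNReal.ofReal (ρ x) ^ (1:ℝ) := by
          rw [← ENNReal.rpow_add_of_nonneg _ _ (by linarith) (by norm_num)]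
          congr 1; ring
      _ ≤ _ := by
          rw [ENNReal.rpow_one]
          gcongr
          · linarith
          · exact hrR x
  have hhol : ∫⁻ x, ENNReal.ofReal (ρ x) * ‖f x‖ₑ ^ (p:ℝ) ≤
      (R ^ (1/2 : ℝ) * ENNReal.ofReal K) ^ (2/3:ℝ) * ((C:ℝ≥0∞) ^ (1/3:ℝ) * M ^ (p:ℝ)) := by
    have hconj : (3/2:ℝ).HolderConjugate 3 := by
      rw [Real.holderConjugate_iff]; norm_num
    let F : E2 → ℝ≥0∞ := fun x => ENNReal.ofReal (ρ x) * wgt x ^ (2/3:ℝ)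
    let G : E2 → ℝ≥0∞ := fun x => ‖f x‖ₑ ^ (p:ℝ) * (wgt x)⁻¹ ^ (2/3:ℝ)
    have hH := ENNReal.lintegral_mul_le_Lp_mul_Lq volume hconj (f := F) (g := G)
      (by apply Measurable.aemeasurable; fun_prop) (by apply Measurable.aemeasurable; fun_prop)
    have e1 : ∀ x, (F * G) x = ENNReal.ofReal (ρ x) * ‖f x‖ₑ ^ (p:ℝ) := by
      intro x
      have : wgt x ^ (2/3:ℝ) * (wgt x)⁻¹ ^ (2/3:ℝ) = 1 := by
        rw [← ENNReal.mul_rpow_of_nonneg _ _ (by norm_num),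
          ENNReal.mul_inv_cancel (wgt_ne_zero x) (wgt_ne_top x), ENNReal.one_rpow]
      calc (F * G) x = ENNReal.ofReal (ρ x) * ‖f x‖ₑ ^ (p:ℝ) *
            (wgt x ^ (2/3:ℝ) * (wgt x)⁻¹ ^ (2/3:ℝ)) := by
            simp only [F, G, Pi.mul_apply]; ring
        _ = _ := by rw [this, mul_one]
    have e2 : ∫⁻ x, F x ^ (3/2:ℝ) ≤ R ^ (1/2:ℝ) * ENNReal.ofReal K := by
      calc _ ≤ ∫⁻ x, R ^ (1/2:ℝ) * (wgt x * ENNReal.ofReal (ρ x)) := by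
            refine lintegral_mono fun x => ?_
            simp only [F]
            rw [ENNReal.mul_rpow_of_nonneg _ _ (by norm_num), ← ENNReal.rpow_mul]
            norm_num only
            rw [show (3/2:ℝ) = 1/2 + 1 by norm_num,
              ENNReal.rpow_add_of_nonneg _ _ (by norm_num) (by norm_num), ENNReal.rpow_one,
              ENNReal.rpow_one, mul_assoc, mul_comm (wgt x)]
            gcongr
            exact hrR x
        _ ≤ _ := by
            rw [lintegral_const_mul _ (by fun_prop)]
            gcongr
    have e3 : ∫⁻ x, G x ^ (3:ℝ) ≤ C * M ^ (3 * (p:ℝ)) := by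
      refine le_trans (le_of_eq ?_) ((hC f hf).trans (le_of_eq (by push_cast; rfl)))
      congr 1; ext x
      simp only [G]
      rw [ENNReal.mul_rpow_of_nonneg _ _ (by norm_num), ← ENNReal.rpow_mul, ← ENNReal.rpow_mul,
        ← ENNReal.rpow_natCast]
      push_cast
      congr 2
      · ring
      · norm_num
    simp_rw [e1] at hH
    refine hH.trans ?_
    calc _ ≤ (R ^ (1/2:ℝ) * ENNReal.ofReal K) ^ (1 / (3/2:ℝ)) * (C * M ^ (3 * (p:ℝ))) ^ (1/3:ℝ) := by
          gcongr
      _ = _ := by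
          rw [ENNReal.mul_rpow_of_nonneg (C:ℝ≥0∞) _ (by norm_num), ← ENNReal.rpow_mul]
          congr 2
          · norm_num
          · congr 1; ring
  calc _ ≤ (c * M ^ (p:ℝ)) ^ (1 / (p:ℝ)) := by
        gcongr
        calc _ ≤ ∫⁻ x, R ^ ((p:ℝ) / 2 - 1) * (ENNReal.ofReal (ρ x) * ‖f x‖ₑ ^ (p:ℝ)) :=
              lintegral_mono hpt
          _ = R ^ ((p:ℝ) / 2 - 1) * ∫⁻ x, (ENNReal.ofReal (ρ x) * ‖f x‖ₑ ^ (p:ℝ)) :=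
              lintegral_const_mul _ (by fun_prop)
          _ ≤ R ^ ((p:ℝ) / 2 - 1) * ((R ^ (1/2 : ℝ) * ENNReal.ofReal K) ^ (2/3:ℝ) *
              ((C:ℝ≥0∞) ^ (1/3:ℝ) * M ^ (p:ℝ))) := by gcongr
          _ = _ := by simp only [c]; ring
    _ = _ := by
        rw [ENNReal.mul_rpow_of_nonneg _ _ (by positivity), ← ENNReal.rpow_mul,
          mul_one_div_cancel (by linarith), ENNReal.rpow_one]

lemma lower (ρM c₀ : ℝ) (hc₀ : 0 < c₀) : ∃ C : ℝ≥0, ∀ ρ f : E2 → ℝ,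
    Measurable ρ → (∀ x, 0 ≤ ρ x) → (∀ x, ρ x ≤ ρM) →
    ENNReal.ofReal c₀ ≤ (∫⁻ x in Metric.ball (0:E2) 1, ENNReal.ofReal (ρ x)) →
    ContDiff ℝ 1 f →
    eLpNorm f 2 (volume.restrict (Metric.ball (0:E2) 1)) ≤
      C * (eLpNorm (fun x => Real.sqrt (ρ x) * f x) 2 volume +
      eLpNorm (fderiv ℝ f) 2 volume) := by
  obtain ⟨C, hC⟩ := poincare_sobolev 2 le_rfl
  set μ := volume.restrict (Metric.ball (0:E2) 1) with hμ
  let V : ℝ≥0∞ := eLpNorm (fun _ : E2 => (1:ℝ)) 2 μ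
  have hVt : V ≠ ∞ := by
    have : IsFiniteMeasure μ := ⟨by simp [hμ, measure_ball_lt_top]⟩
    exact (memLp_const (1:ℝ)).eLpNorm_ne_top
  let s : ℝ≥0∞ := ENNReal.ofReal (Real.sqrt c₀)
  have hs0 : s ≠ 0 := by simpa [s] using hc₀
  have hst : s ≠ ∞ := by simp [s]
  let L : ℝ≥0∞ := ENNReal.ofReal (Real.sqrt ρM)
  have hLt : L ≠ ∞ := by simp [L]
  let c : ℝ≥0∞ := C + s⁻¹ * V * (1 + L * C)
  have hct : c ≠ ∞ := by
    refine ENNReal.add_ne_top.2 ⟨by simp, ENNReal.mul_ne_top (ENNReal.mul_ne_top (by simp [hs0]) hVt) ?_⟩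
    exact ENNReal.add_ne_top.2 ⟨by simp, ENNReal.mul_ne_top hLt (by simp)⟩
  refine ⟨c.toNNReal, fun ρ f hρ h0 hM hc hf => ?_⟩
  rw [ENNReal.coe_toNNReal hct]
  have hfc := hf.continuous
  have hfm := hfc.measurable
  obtain ⟨m, hm⟩ := hC f hf
  set D := eLpNorm (fderiv ℝ f) 2 volume
  set T := eLpNorm (fun x => Real.sqrt (ρ x) * f x) 2 volume
  have hm' : eLpNorm (fun x => f x - m) 2 μ ≤ C * D := hm
  have hconst : eLpNorm (fun _ : E2 => m) 2 μ = ‖m‖ₑ * V := by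
    have := eLpNorm_const_smul (μ := μ) (p := 2) m (fun _ : E2 => (1:ℝ))
    rw [← this]; congr 1; ext x; simp
  have h1 : s * ‖m‖ₑ ≤ T + L * (C * D) := by
    calc s * ‖m‖ₑ ≤ eLpNorm (fun x => Real.sqrt (ρ x) * m) 2 μ := by
          rw [← ENNReal.pow_le_pow_left_iff two_ne_zero, eLpNorm_two_sq, mul_pow]
          have e : ∀ x, ‖Real.sqrt (ρ x) * m‖ₑ ^ 2 = ENNReal.ofReal (ρ x) * ‖m‖ₑ ^ 2 := by
            intro x
            rw [enorm_mul, mul_pow, Real.enorm_eq_ofReal (Real.sqrt_nonneg _),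
              ← ENNReal.ofReal_pow (Real.sqrt_nonneg _), Real.sq_sqrt (h0 x)]
          simp_rw [e]
          rw [lintegral_mul_const _ (by fun_prop)]
          gcongr
          simp only [s]
          rwa [← ENNReal.ofReal_pow (Real.sqrt_nonneg _), Real.sq_sqrt hc₀.le]
      _ = eLpNorm ((fun x => Real.sqrt (ρ x) * f x) - fun x => Real.sqrt (ρ x) * (f x - m)) 2 μ := by
          congr 1; ext x; simp; ring
      _ ≤ eLpNorm (fun x => Real.sqrt (ρ x) * f x) 2 μ
          + eLpNorm (fun x => Real.sqrt (ρ x) * (f x - m)) 2 μ := by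
          apply eLpNorm_sub_le _ _ (by norm_num)
          · exact (by fun_prop : Measurable _).aestronglyMeasurable
          · exact (by fun_prop : Measurable _).aestronglyMeasurable
      _ ≤ T + L * (C * D) := by
          gcongr
          · exact eLpNorm_mono_measure _ Measure.restrict_le_self
          · calc _ ≤ eLpNorm (Real.sqrt ρM • (fun x => f x - m)) 2 μ := by
                  apply eLpNorm_mono
                  intro x
                  simp only [Pi.smul_apply, smul_eq_mul, norm_mul,
                    Real.norm_of_nonneg (Real.sqrt_nonneg _)]
                  gcongr
                  exact hM x
              _ ≤ _ := by
                  rw [eLpNorm_const_smul, Real.enorm_eq_ofReal (Real.sqrt_nonneg _)]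
                  gcongr
  have h2 : ‖m‖ₑ ≤ s⁻¹ * (T + L * (C * D)) := by
    calc ‖m‖ₑ = s⁻¹ * (s * ‖m‖ₑ) := by
          rw [← mul_assoc, ENNReal.inv_mul_cancel hs0 hst, one_mul]
      _ ≤ _ := by gcongr
  calc eLpNorm f 2 μ = eLpNorm ((fun x => f x - m) + (fun _ => m)) 2 μ := by
        congr 1; ext x; simp
    _ ≤ eLpNorm (fun x => f x - m) 2 μ + eLpNorm (fun _ : E2 => m) 2 μ :=
        eLpNorm_add_le (by fun_prop : Continuous _).aestronglyMeasurable
          (by fun_prop : Continuous _).aestronglyMeasurable (by norm_num)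
    _ ≤ C * D + s⁻¹ * (T + L * (C * D)) * V := by
        rw [hconst]; gcongr
    _ ≤ C * D + s⁻¹ * (T + L * (C * D)) * V + (C * T + s⁻¹ * V * (D + L * C * T)) := le_self_add
    _ = _ := by simp only [c]; ring

lemma lp_real (p : ℝ≥0) (hp : p ≠ 0) (u : E2 → ℝ) (hu : Measurable u) (μ : Measure E2) :
    (∫ x, |u x| ^ (p:ℝ) ∂μ) ^ (1 / (p:ℝ)) = (eLpNorm u p μ).toReal := by
  rw [eLpNorm_nnreal_eq_lintegral hp, ← ENNReal.toReal_rpow, integral_eq_lintegral_of_nonneg_ae]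
  · congr 2
    refine lintegral_congr fun x => ?_
    rw [← ENNReal.ofReal_rpow_of_nonneg (abs_nonneg _) (by positivity), ← Real.norm_eq_abs, ofReal_norm]
  · exact Filter.Eventually.of_forall fun x => by positivity
  · exact (by fun_prop : Measurable _).aestronglyMeasurable

lemma l2_real {F : Type*} [NormedAddCommGroup F] (u : E2 → F) (μ : Measure E2)
    (hu : AEStronglyMeasurable u μ) :
    Real.sqrt (∫ x, ‖u x‖ ^ 2 ∂μ) = (eLpNorm u 2 μ).toReal := by
  rw [Real.sqrt_eq_iff_eq_sq (integral_nonneg fun x => by positivity) (by positivity),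
    ← ENNReal.toReal_pow, eLpNorm_two_sq, integral_eq_lintegral_of_nonneg_ae]
  · congr 1
    refine lintegral_congr fun x => ?_
    rw [ENNReal.ofReal_pow (norm_nonneg _), ofReal_norm]
  · exact Filter.Eventually.of_forall fun x => by positivity
  · exact hu.norm.pow 2

lemma l2_fin {F : Type*} [NormedAddCommGroup F] (u : E2 → F) (μ : Measure E2)
    (h : Integrable (fun x => ‖u x‖ ^ 2) μ) : eLpNorm u 2 μ ≠ ∞ := by
  have h1 : eLpNorm u 2 μ ^ 2 ≠ ∞ := by
    rw [eLpNorm_two_sq]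
    have := h.lintegral_lt_top.ne
    convert this using 3 with x
    rw [ENNReal.ofReal_pow (norm_nonneg _), ofReal_norm]
  exact fun h2 => h1 (by rw [h2]; simp)

theorem weighted_Lp_two_sided_control
    (p ρM K c₀ : ℝ) (hp : 2 ≤ p) (hρM : 0 < ρM) (hK : 0 < K) (hc₀ : 0 < c₀) :
    ∃ C > 0, ∀ (ρ f : E2 → ℝ),
      Measurable ρ → (∀ x, 0 ≤ ρ x) → (∀ x, ρ x ≤ ρM) →
      Integrable (fun x => (1 + ‖x‖ ^ 2) * ρ x) →
      (∫ x, (1 + ‖x‖ ^ 2) * ρ x) ≤ K →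
      c₀ ≤ (∫ x in Metric.ball (0 : E2) 1, ρ x) →
      ContDiff ℝ 1 f →
      Integrable (fun x => ‖gradient f x‖ ^ 2) →
      IntegrableOn (fun x => (f x) ^ 2) (Metric.ball (0 : E2) 1) →
      C⁻¹ * (∫ x, |Real.sqrt (ρ x) * f x| ^ p) ^ (1 / p)
          ≤ Real.sqrt (∫ x in Metric.ball (0 : E2) 1, (f x) ^ 2)
            + Real.sqrt (∫ x, ‖gradient f x‖ ^ 2)
        ∧ Real.sqrt (∫ x in Metric.ball (0 : E2) 1, (f x) ^ 2)
            + Real.sqrt (∫ x, ‖gradient f x‖ ^ 2)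
          ≤ C * (Real.sqrt (∫ x, (Real.sqrt (ρ x) * f x) ^ 2)
            + Real.sqrt (∫ x, ‖gradient f x‖ ^ 2)) := by
  lift p to ℝ≥0 using by linarith
  have hp' : 2 ≤ p := by exact_mod_cast hp
  have hp0 : p ≠ 0 := by rintro rfl; norm_num at hp
  obtain ⟨C1, h1⟩ := upper p hp' ρM K
  obtain ⟨C2, h2⟩ := upper 2 le_rfl ρM K
  obtain ⟨C3, h3⟩ := lower ρM c₀ hc₀
  refine ⟨C1 + C3 + 1, by positivity, fun ρ f hρ h0 hM hi hiK hc hf hgrad hL2 => ?_⟩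
  have hgn : ∀ x, ‖gradient f x‖ = ‖fderiv ℝ f x‖ := fun x => by simp [gradient]
  simp_rw [hgn] at hgrad ⊢
  have hfc := hf.continuous
  have hfm := hfc.measurable
  have hcf : Continuous (fderiv ℝ f) := hf.continuous_fderiv one_ne_zero
  have hKl : (∫⁻ x, wgt x * ENNReal.ofReal (ρ x)) ≤ ENNReal.ofReal K := by
    have : (∫⁻ x, wgt x * ENNReal.ofReal (ρ x)) = ENNReal.ofReal (∫ x, (1 + ‖x‖ ^ 2) * ρ x) := by
      rw [ofReal_integral_eq_lintegral_ofReal hi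
        (Filter.Eventually.of_forall fun x => mul_nonneg (by positivity) (h0 x))]
      refine lintegral_congr fun x => ?_
      rw [wgt, ENNReal.ofReal_mul (by positivity)]
    rw [this]; exact ENNReal.ofReal_le_ofReal hiK
  have hcl : ENNReal.ofReal c₀ ≤ (∫⁻ x in Metric.ball (0:E2) 1, ENNReal.ofReal (ρ x)) := by
    refine ENNReal.ofReal_le_of_le_toReal ?_
    rwa [← integral_eq_lintegral_of_nonneg_ae (Filter.Eventually.of_forall h0)
      hρ.aestronglyMeasurable]
  have hsq : ∀ a : ℝ, a ^ 2 = ‖a‖ ^ 2 := fun a => by simp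
  have hD : eLpNorm (fderiv ℝ f) 2 volume ≠ ∞ := l2_fin _ _ hgrad
  have hA : eLpNorm f 2 (volume.restrict (Metric.ball (0:E2) 1)) ≠ ∞ :=
    l2_fin _ _ (by simp_rw [← hsq]; exact hL2)
  have hsm : Measurable (fun x => Real.sqrt (ρ x) * f x) := by fun_prop
  have e1 : Real.sqrt (∫ x in Metric.ball (0 : E2) 1, (f x) ^ 2)
      = (eLpNorm f 2 (volume.restrict (Metric.ball (0:E2) 1))).toReal := by
    rw [← l2_real f _ hfc.aestronglyMeasurable]
    simp_rw [← hsq]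
  have e2 : Real.sqrt (∫ x, (Real.sqrt (ρ x) * f x) ^ 2)
      = (eLpNorm (fun x => Real.sqrt (ρ x) * f x) 2 volume).toReal := by
    rw [← l2_real _ _ hsm.aestronglyMeasurable]
    simp_rw [← hsq]
  have e3 := l2_real (fderiv ℝ f) volume hcf.aestronglyMeasurable
  rw [e1, e2, e3, lp_real p hp0 _ hsm]
  replace h1 := h1 ρ f hρ h0 hM hKl hf
  replace h2 := h2 ρ f hρ h0 hM hKl hf
  replace h3 := h3 ρ f hρ h0 hM hcl hf
  set A := eLpNorm f 2 (volume.restrict (Metric.ball (0:E2) 1))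
  set D := eLpNorm (fderiv ℝ f) 2 volume
  have hT : eLpNorm (fun x => Real.sqrt (ρ x) * f x) 2 volume ≠ ∞ :=
    ne_top_of_le_ne_top (ENNReal.mul_ne_top (by simp) (ENNReal.add_ne_top.2 ⟨hA, hD⟩)) h2
  set T := eLpNorm (fun x => Real.sqrt (ρ x) * f x) 2 volume
  have r1 := ENNReal.toReal_mono (ENNReal.mul_ne_top (by simp) (ENNReal.add_ne_top.2 ⟨hA, hD⟩)) h1
  have r3 := ENNReal.toReal_mono (ENNReal.mul_ne_top (by simp) (ENNReal.add_ne_top.2 ⟨hT, hD⟩)) h3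
  rw [ENNReal.toReal_mul, ENNReal.toReal_add hA hD, ENNReal.coe_toReal] at r1
  rw [ENNReal.toReal_mul, ENNReal.toReal_add hT hD, ENNReal.coe_toReal] at r3
  have a0 : 0 ≤ A.toReal := ENNReal.toReal_nonneg
  have d0 : 0 ≤ D.toReal := ENNReal.toReal_nonneg
  have t0 : 0 ≤ T.toReal := ENNReal.toReal_nonneg
  have c1 : (0:ℝ) ≤ C1 := C1.2
  have c3 : (0:ℝ) ≤ C3 := C3.2
  constructor
  · rw [inv_mul_le_iff₀ (by positivity)]
    refine r1.trans ?_
    gcongr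
    linarith
  · have : (C1 + C3 + 1 : ℝ) * (T.toReal + D.toReal) = C3 * (T.toReal + D.toReal) + D.toReal
        + (C1 * (T.toReal + D.toReal) + T.toReal) := by ring
    rw [this]
    have : 0 ≤ C1 * (T.toReal + D.toReal) + T.toReal := by positivity
    linarith
end

section
/- For every p ∈ (2,∞) there exists a constant C>0 such that the following holds. Let ρ ∈ L^∞(𝕋²) with 0 ≤ ρ ≤ ρ^M for some ρ^M > 0 and ρ not almost everywhere zero, set M = ∫_{𝕋²} ρ dx, and let f:𝕋²→ℝ² be a continuously differentiable vector field with ∫_{𝕋²} ρ f dx = 0 and ‖√ρ f‖_{L²} ≠ 0. Then ∫_{𝕋²} ρ |f|^p dx ≤ C ‖√ρ f‖²_{L²} ‖∇f‖^{p−2}_{L²} log^{(p−2)/2}( e + ‖ρ − M‖²_{L²}/M² + ρ^M ‖∇f‖²_{L²}/‖√ρ f‖²_{L²} ). -/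
open MeasureTheory

/-- Partial derivative `∂ᵢ f` of a scalar function on `ℝ²`. -/
noncomputable def pd (f : (Fin 2 → ℝ) → ℝ) (i : Fin 2) (x : Fin 2 → ℝ) : ℝ :=
  fderiv ℝ f x (Pi.single i 1)

/-- A function on `ℝ²` is `ℤ²`-periodic, i.e. descends to the torus `𝕋² = (ℝ/ℤ)²`. -/
def Per (f : (Fin 2 → ℝ) → ℝ) : Prop :=
  ∀ (x : Fin 2 → ℝ) (k : Fin 2 → ℤ), f (x + fun i => (k i : ℝ)) = f x

/-- The fundamental domain of the torus `𝕋² = (ℝ/ℤ)²`. -/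
def T2 : Set (Fin 2 → ℝ) := Set.Icc 0 1


open scoped ENNReal

/-- Change of variables for a homothety. -/
lemma lintegral_homothety (φ : (Fin 2 → ℝ) → ℝ≥0∞) (hφ : Measurable φ) (x : Fin 2 → ℝ)
    (t : ℝ) (ht : 0 < t) :
    ∫⁻ y, φ (x + t • (y - x)) = ENNReal.ofReal ((t ^ 2)⁻¹) * ∫⁻ z, φ z := by
  have h1 : ∫⁻ y, φ (x + t • (y - x)) = ∫⁻ y, φ (x + t • y) :=
    lintegral_sub_right_eq_self (fun y => φ (x + t • y)) x
  have h2 : ∫⁻ z, φ z = ∫⁻ z, φ (x + z) := (lintegral_add_left_eq_self φ x).symm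
  have h3 := Measure.map_addHaar_smul (volume : Measure (Fin 2 → ℝ)) ht.ne'
  have hm : Measurable (fun z => φ (x + z)) := hφ.comp (measurable_const_add x)
  have h4 : ∫⁻ z, φ (x + z) ∂(Measure.map (t • ·) (volume : Measure (Fin 2 → ℝ)))
      = ∫⁻ y, φ (x + t • y) :=
    lintegral_map hm (measurable_const_smul t)
  rw [h1, h2, ← h4, h3, lintegral_smul_measure]
  simp [abs_of_pos ht]

lemma T2_meas : MeasurableSet T2 := measurableSet_Icc

lemma T2_vol : volume T2 = 1 := by
  unfold T2
  rw [Real.volume_Icc_pi]; simp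

lemma T2_mem_homothety {x y : Fin 2 → ℝ} (hx : x ∈ T2) (hy : y ∈ T2) {t : ℝ} (h0 : 0 ≤ t)
    (h1 : t ≤ 1) : x + t • (y - x) ∈ T2 :=
  (convex_Icc (0 : Fin 2 → ℝ) 1).add_smul_sub_mem hx hy ⟨h0, h1⟩

lemma T2_dist {x y : Fin 2 → ℝ} (hx : x ∈ T2) (hy : y ∈ T2) : ‖y - x‖ ≤ 1 := by
  rw [pi_norm_le_iff_of_nonneg zero_le_one]
  intro i
  have a := hx.1 i; have b := hx.2 i; have c := hy.1 i; have d := hy.2 i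
  simp at a b c d
  rw [Pi.sub_apply, Real.norm_eq_abs, abs_le]; constructor <;> linarith

/-- Integration in `t` of the kernel. -/
lemma lintegral_kernel (r : ℝ) (hr : 0 ≤ r) :
    ∫⁻ t in Set.Ioc (0:ℝ) 1, ENNReal.ofReal ((t ^ 2)⁻¹) * (if r ≤ t then ENNReal.ofReal r else 0)
      ≤ 1 := by
  rcases hr.eq_or_lt with rfl | hr
  · simp
  rcases lt_or_ge 1 r with h1 | h1
  · rw [setLIntegral_congr_fun (g := fun _ => 0) measurableSet_Ioc]
    · simp
    · intro t ht
      have : ¬ r ≤ t := by have := ht.2; linarith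
      simp [this]
  have e1 : ∀ t : ℝ, ENNReal.ofReal ((t ^ 2)⁻¹) * (if r ≤ t then ENNReal.ofReal r else 0)
      = (Set.Ici r).indicator (fun t => ENNReal.ofReal (r * (t ^ 2)⁻¹)) t := by
    intro t
    by_cases h : r ≤ t
    · simp only [Set.indicator, Set.mem_Ici, h, if_true]
      rw [mul_comm, ENNReal.ofReal_mul hr.le]
    · simp [Set.indicator, h]
  simp_rw [e1]
  rw [setLIntegral_indicator measurableSet_Ici]
  have e2 : Set.Ici r ∩ Set.Ioc 0 1 = Set.Icc r 1 := by
    ext t; simp only [Set.mem_inter_iff, Set.mem_Ici, Set.mem_Ioc, Set.mem_Icc]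
    constructor
    · rintro ⟨a, b, c⟩; exact ⟨a, c⟩
    · rintro ⟨a, b⟩; exact ⟨a, by linarith, b⟩
  have hcont : ContinuousOn (fun t : ℝ => r * (t ^ 2)⁻¹) (Set.Icc r 1) := by
    apply ContinuousOn.mul continuousOn_const
    apply ContinuousOn.inv₀ (by fun_prop)
    intro t ht; have : 0 < t := lt_of_lt_of_le hr ht.1
    positivity
  rw [e2, ← ofReal_integral_eq_lintegral_ofReal hcont.integrableOn_Icc]
  · rw [integral_Icc_eq_integral_Ioc, ← intervalIntegral.integral_of_le h1]
    have : ∫ t in r..1, r * (t ^ 2)⁻¹ = (-(r * (1:ℝ)⁻¹)) - (-(r * r⁻¹)) := by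
      apply intervalIntegral.integral_eq_sub_of_hasDerivAt (f := fun t => -(r * t⁻¹))
      · intro t ht
        rw [Set.uIcc_of_le h1] at ht
        have ht0 : t ≠ 0 := by have := ht.1; linarith
        have := ((hasDerivAt_inv ht0).const_mul r).neg
        exact this.congr_deriv (by ring)
      · exact ContinuousOn.intervalIntegrable_of_Icc h1 hcont
    rw [this]
    rw [ENNReal.ofReal_le_one]
    rw [mul_inv_cancel₀ hr.ne']; linarith
  · exact Filter.Eventually.of_forall (fun t => by simp only [Pi.zero_apply]; positivity)

lemma lintegral_F (h : (Fin 2 → ℝ) → ℝ) (hc : Continuous h) (x : Fin 2 → ℝ) (hx : x ∈ T2) :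
    ∫⁻ t in Set.Ioc (0:ℝ) 1, ∫⁻ y in T2, ENNReal.ofReal (h (x + t • (y - x)) ^ 2 * (t * ‖y - x‖))
      ≤ ∫⁻ z in T2, ENNReal.ofReal (h z ^ 2) := by
  set φ : (Fin 2 → ℝ) → ℝ≥0∞ := T2.indicator (fun z => ENNReal.ofReal (h z ^ 2)) with hφ
  have hφm : Measurable φ := by
    apply Measurable.indicator _ T2_meas
    fun_prop
  set ψ : ℝ → (Fin 2 → ℝ) → ℝ≥0∞ := fun t z =>
    φ z * (if ‖z - x‖ ≤ t then ENNReal.ofReal ‖z - x‖ else 0) with hψ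
  have hψm2 : Measurable (Function.uncurry ψ) := by
    apply Measurable.mul (hφm.comp measurable_snd)
    apply Measurable.ite
    · exact measurableSet_le (by fun_prop) (by fun_prop)
    · fun_prop
    · fun_prop
  have hψm : ∀ t, Measurable (ψ t) := fun t => hψm2.comp measurable_prodMk_left
  have step1 : ∀ t ∈ Set.Ioc (0:ℝ) 1,
      ∫⁻ y in T2, ENNReal.ofReal (h (x + t • (y - x)) ^ 2 * (t * ‖y - x‖))
      ≤ ENNReal.ofReal ((t ^ 2)⁻¹) * ∫⁻ z, ψ t z := by
    intro t ht
    rw [← lintegral_homothety (ψ t) (hψm t) x t ht.1, ← lintegral_indicator T2_meas]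
    apply lintegral_mono
    intro y
    by_cases hy : y ∈ T2
    · have hz := T2_mem_homothety hx hy ht.1.le ht.2
      have hn : ‖x + t • (y - x) - x‖ = t * ‖y - x‖ := by
        rw [add_sub_cancel_left, norm_smul, Real.norm_of_nonneg ht.1.le]
      have hle : t * ‖y - x‖ ≤ t := by
        have := T2_dist hx hy
        nlinarith [ht.1]
      simp only [hψ, hφ, Set.indicator_of_mem hy, Set.indicator_of_mem hz, hn, hle, if_true]
      rw [ENNReal.ofReal_mul (by positivity)]
    · simp [Set.indicator_of_notMem hy]
  calc _ ≤ ∫⁻ t in Set.Ioc (0:ℝ) 1, ENNReal.ofReal ((t ^ 2)⁻¹) * ∫⁻ z, ψ t z :=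
        setLIntegral_mono' measurableSet_Ioc step1
    _ = ∫⁻ t in Set.Ioc (0:ℝ) 1, ∫⁻ z, ENNReal.ofReal ((t ^ 2)⁻¹) * ψ t z := by
        simp_rw [lintegral_const_mul _ (hψm _)]
    _ = ∫⁻ z, ∫⁻ t in Set.Ioc (0:ℝ) 1, ENNReal.ofReal ((t ^ 2)⁻¹) * ψ t z := by
        apply lintegral_lintegral_swap
        apply Measurable.aemeasurable
        apply Measurable.mul _ hψm2
        fun_prop
    _ ≤ ∫⁻ z, φ z := by
        apply lintegral_mono
        intro z
        have := lintegral_kernel ‖z - x‖ (norm_nonneg _)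
        calc _ = ∫⁻ t in Set.Ioc (0:ℝ) 1, φ z * (ENNReal.ofReal ((t ^ 2)⁻¹) *
                (if ‖z - x‖ ≤ t then ENNReal.ofReal ‖z - x‖ else 0)) := by
                refine lintegral_congr fun t => ?_
                simp only [hψ]; ring
          _ = φ z * _ := by
                rw [lintegral_const_mul]
                apply Measurable.mul (by fun_prop)
                exact Measurable.ite (measurableSet_le measurable_const measurable_id)
                  measurable_const measurable_const
          _ ≤ φ z * 1 := by gcongr
          _ = φ z := mul_one _
    _ = _ := by rw [hφ, lintegral_indicator T2_meas]

/-- The auxiliary maximal-type function. -/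
noncomputable def Waux (h : (Fin 2 → ℝ) → ℝ) (x : Fin 2 → ℝ) : ℝ≥0∞ :=
  ∫⁻ t in Set.Ioc (0:ℝ) 1, ∫⁻ y in T2, ENNReal.ofReal (h (x + t • (y - x)) ^ 2)

lemma Waux_meas (h : (Fin 2 → ℝ) → ℝ) (hc : Continuous h) : Measurable (Waux h) := by
  unfold Waux
  apply Measurable.lintegral_prod_right' (f := fun (q : (Fin 2 → ℝ) × ℝ) =>
    ∫⁻ y in T2, ENNReal.ofReal (h (q.1 + q.2 • (y - q.1)) ^ 2))
  apply Measurable.lintegral_prod_right' (f := fun (q : ((Fin 2 → ℝ) × ℝ) × (Fin 2 → ℝ)) =>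
    ENNReal.ofReal (h (q.1.1 + q.1.2 • (q.2 - q.1.1)) ^ 2))
  have : Continuous (fun (q : ((Fin 2 → ℝ) × ℝ) × (Fin 2 → ℝ)) =>
    (h (q.1.1 + q.1.2 • (q.2 - q.1.1)) ^ 2)) := by fun_prop
  exact ENNReal.measurable_ofReal.comp this.measurable

lemma half_bound_s12 (h : (Fin 2 → ℝ) → ℝ) (hc : Continuous h) (x : Fin 2 → ℝ) (hx : x ∈ T2)
    (t : ℝ) (ht : 1 / 2 ≤ t) (ht1 : t ≤ 1) :
    ∫⁻ y in T2, ENNReal.ofReal (h (x + t • (y - x)) ^ 2)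
      ≤ 4 * ∫⁻ z in T2, ENNReal.ofReal (h z ^ 2) := by
  have ht0 : 0 < t := by linarith
  set φ : (Fin 2 → ℝ) → ℝ≥0∞ := T2.indicator (fun z => ENNReal.ofReal (h z ^ 2)) with hφ
  have hφm : Measurable φ := by
    apply Measurable.indicator _ T2_meas
    fun_prop
  calc _ ≤ ∫⁻ y, φ (x + t • (y - x)) := by
        rw [← lintegral_indicator T2_meas]
        apply lintegral_mono
        intro y
        by_cases hy : y ∈ T2
        · have hz := T2_mem_homothety hx hy ht0.le ht1
          simp only [hφ, Set.indicator_of_mem hy, Set.indicator_of_mem hz, le_refl]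
        · simp [Set.indicator_of_notMem hy]
    _ = ENNReal.ofReal ((t ^ 2)⁻¹) * ∫⁻ z, φ z := lintegral_homothety φ hφm x t ht0
    _ ≤ 4 * ∫⁻ z, φ z := by
        gcongr
        rw [show (4 : ℝ≥0∞) = ENNReal.ofReal 4 by simp]
        apply ENNReal.ofReal_le_ofReal
        rw [inv_le_comm₀ (by positivity) (by norm_num)]
        nlinarith
    _ = _ := by rw [hφ, lintegral_indicator T2_meas]

lemma lintegral_W (h : (Fin 2 → ℝ) → ℝ) (hc : Continuous h) :
    ∫⁻ x in T2, Waux h x ≤ 4 * ∫⁻ z in T2, ENNReal.ofReal (h z ^ 2) := by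
  set B := 4 * ∫⁻ z in T2, ENNReal.ofReal (h z ^ 2) with hB
  have hvol : ∀ c : ℝ≥0∞, ∫⁻ _ in T2, c = c := by
    intro c; rw [setLIntegral_const, T2_vol, mul_one]
  have key : ∀ t ∈ Set.Ioc (0:ℝ) 1,
      ∫⁻ x in T2, ∫⁻ y in T2, ENNReal.ofReal (h (x + t • (y - x)) ^ 2) ≤ B := by
    intro t ht
    rcases le_total (1/2) t with h2 | h2
    · calc _ ≤ ∫⁻ _ in T2, B :=
            setLIntegral_mono' T2_meas (fun x hx => half_bound_s12 h hc x hx t h2 ht.2)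
        _ = B := hvol B
    · rw [lintegral_lintegral_swap]
      · calc _ ≤ ∫⁻ _ in T2, B := by
              apply setLIntegral_mono' T2_meas
              intro y hy
              have := half_bound_s12 h hc y hy (1 - t) (by linarith) (by linarith [ht.1])
              refine le_trans (le_of_eq ?_) this
              congr 1; ext x; congr 3
              module
          _ = B := hvol B
      · apply Measurable.aemeasurable
        have : Continuous (fun (q : (Fin 2 → ℝ) × (Fin 2 → ℝ)) =>
          (h (q.1 + t • (q.2 - q.1)) ^ 2)) := by fun_prop
        exact ENNReal.measurable_ofReal.comp this.measurable
  unfold Waux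
  rw [lintegral_lintegral_swap]
  · calc _ ≤ ∫⁻ t in Set.Ioc (0:ℝ) 1, B := setLIntegral_mono' measurableSet_Ioc key
      _ = B := by rw [setLIntegral_const]; simp
  · apply Measurable.aemeasurable
    apply Measurable.lintegral_prod_right' (f := fun (q : ((Fin 2 → ℝ) × ℝ) × (Fin 2 → ℝ)) =>
      ENNReal.ofReal (h (q.1.1 + q.1.2 • (q.2 - q.1.1)) ^ 2))
    have : Continuous (fun (q : ((Fin 2 → ℝ) × ℝ) × (Fin 2 → ℝ)) =>
      (h (q.1.1 + q.1.2 • (q.2 - q.1.1)) ^ 2)) := by fun_prop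
    exact ENNReal.measurable_ofReal.comp this.measurable

lemma integral_inv_lin (α l : ℝ) (hα : 0 < α) (hl : 0 < l) :
    ∫⁻ t in Set.Ioc (0:ℝ) 1, ENNReal.ofReal ((α + l * t)⁻¹)
      = ENNReal.ofReal (Real.log (1 + l / α) / l) := by
  have hpos : ∀ t ∈ Set.Icc (0:ℝ) 1, 0 < α + l * t := by
    intro t ht; have := ht.1; positivity
  have hcont : ContinuousOn (fun t : ℝ => (α + l * t)⁻¹) (Set.Icc 0 1) :=
    ContinuousOn.inv₀ (by fun_prop) (fun t ht => (hpos t ht).ne')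
  rw [← ofReal_integral_eq_lintegral_ofReal (hcont.integrableOn_Icc.mono_set Set.Ioc_subset_Icc_self)]
  · rw [← intervalIntegral.integral_of_le zero_le_one]
    have : ∫ t in (0:ℝ)..1, (α + l * t)⁻¹
        = Real.log (α + l * 1) / l - Real.log (α + l * 0) / l := by
      apply intervalIntegral.integral_eq_sub_of_hasDerivAt (f := fun t => Real.log (α + l * t) / l)
      · intro t ht
        rw [Set.uIcc_of_le zero_le_one] at ht
        have h1 : HasDerivAt (fun t : ℝ => α + l * t) l t := by
          simpa using ((hasDerivAt_id t).const_mul l).const_add α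
        have h2 := (h1.log (hpos t ht).ne').div_const l
        refine h2.congr_deriv ?_
        have := (hpos t ht).ne'
        field_simp
      · exact ContinuousOn.intervalIntegrable_of_Icc zero_le_one hcont
    rw [this, ← sub_div, ← Real.log_div (by positivity) (by simpa using hα.ne')]
    congr 3
    field_simp
    simp
  · filter_upwards [ae_restrict_mem measurableSet_Ioc] with t ht
    have := hpos t ⟨ht.1.le, ht.2⟩
    simp only [Pi.zero_apply]; positivity

lemma amgm_kernel (h r t α l : ℝ) (hr : 0 ≤ r) (hr1 : r ≤ 1) (ht : 0 < t) (hα : 0 < α)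
    (hl : 0 < l) : 2 * (h * r) ≤ α * h ^ 2 + l * (h ^ 2 * (t * r)) + (α + l * t)⁻¹ := by
  set a := α + l * t * r with ha
  have ha0 : 0 < a := by positivity
  have hb0 : 0 < α + l * t := by positivity
  have h1 : 2 * (h * r) ≤ a * h ^ 2 + r ^ 2 / a := by
    have : a * h ^ 2 + r ^ 2 / a - 2 * (h * r) = (a * h - r) ^ 2 / a := by
      field_simp; ring
    have h3 : 0 ≤ (a * h - r) ^ 2 / a := by positivity
    linarith
  have h2 : r ^ 2 / a ≤ (α + l * t)⁻¹ := by
    rw [div_le_iff₀ ha0, inv_mul_eq_div, le_div_iff₀ hb0, ha]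
    have e1 : r ^ 2 ≤ r := by nlinarith
    have e2 : 0 < l * t := by positivity
    nlinarith
  have : a * h ^ 2 = α * h ^ 2 + l * (h ^ 2 * (t * r)) := by rw [ha]; ring
  linarith

lemma pointwise_lin (f : (Fin 2 → ℝ) → Fin 2 → ℝ) (hf : ContDiff ℝ 1 f) (x : Fin 2 → ℝ)
    (hx : x ∈ T2) (α l : ℝ) (hα : 0 < α) (hl : 0 < l) :
    ENNReal.ofReal (2 * ‖f x - ∫ y in T2, f y‖) ≤
      ENNReal.ofReal α * Waux (fun z => ‖fderiv ℝ f z‖) x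
      + ENNReal.ofReal l * (∫⁻ z in T2, ENNReal.ofReal (‖fderiv ℝ f z‖ ^ 2))
      + ENNReal.ofReal (Real.log (1 + l / α) / l) := by
  set h : (Fin 2 → ℝ) → ℝ := fun z => ‖fderiv ℝ f z‖ with hh
  have hd : Continuous (fderiv ℝ f) := hf.continuous_fderiv one_ne_zero
  have hc : Continuous h := hd.norm
  have hfc : Continuous f := hf.continuous
  have hfi : IntegrableOn f T2 := hfc.continuousOn.integrableOn_compact isCompact_Icc
  have : IsFiniteMeasure (volume.restrict T2) := ⟨by simp [T2_vol]⟩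
  have e0 : f x - ∫ y in T2, f y = ∫ y in T2, (f x - f y) := by
    rw [integral_sub (integrable_const _) hfi]
    simp [Measure.real, T2_vol]
  have e1 : ∀ y, ‖f x - f y‖ₑ ≤
      ∫⁻ t in Set.Ioc (0:ℝ) 1, ENNReal.ofReal (h (x + t • (y - x)) * ‖y - x‖) := by
    intro y
    have hder : ∀ t ∈ Set.uIcc (0:ℝ) 1, HasDerivAt (fun t : ℝ => f (x + t • (y - x)))
        (fderiv ℝ f (x + t • (y - x)) (y - x)) t := by
      intro t _
      have h1 : HasDerivAt (fun t : ℝ => x + t • (y - x)) (y - x) t := by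
        simpa using ((hasDerivAt_id t).smul_const (y - x)).const_add x
      exact ((hf.differentiable one_ne_zero _).hasFDerivAt).comp_hasDerivAt t h1
    have hcd : Continuous (fun t : ℝ => fderiv ℝ f (x + t • (y - x)) (y - x)) :=
      (hd.comp (by fun_prop)).clm_apply continuous_const
    have hint := intervalIntegral.integral_eq_sub_of_hasDerivAt hder (hcd.intervalIntegrable 0 1)
    have e : f y - f x = ∫ t in Set.Ioc (0:ℝ) 1, fderiv ℝ f (x + t • (y - x)) (y - x) := by
      rw [← intervalIntegral.integral_of_le zero_le_one, hint]; simp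
    rw [← enorm_neg, neg_sub, e]
    refine (enorm_integral_le_lintegral_enorm _).trans (lintegral_mono fun t => ?_)
    rw [← ofReal_norm]
    exact ENNReal.ofReal_le_ofReal (ContinuousLinearMap.le_opNorm _ _)
  have hcont3 : Continuous (fun q : (Fin 2 → ℝ) × ℝ => h (x + q.2 • (q.1 - x))) := by fun_prop
  have e2 : ENNReal.ofReal ‖f x - ∫ y in T2, f y‖ ≤
      ∫⁻ t in Set.Ioc (0:ℝ) 1, ∫⁻ y in T2, ENNReal.ofReal (h (x + t • (y - x)) * ‖y - x‖) := by
    rw [← lintegral_lintegral_swap]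
    · rw [e0, ofReal_norm]
      exact (enorm_integral_le_lintegral_enorm _).trans (lintegral_mono e1)
    · apply Measurable.aemeasurable
      have : Continuous (fun q : (Fin 2 → ℝ) × ℝ => h (x + q.2 • (q.1 - x)) * ‖q.1 - x‖) := by
        fun_prop
      exact ENNReal.measurable_ofReal.comp this.measurable
  have m1 : ∀ t : ℝ, Measurable (fun y => ENNReal.ofReal (h (x + t • (y - x)) ^ 2)) := by
    intro t
    have : Continuous (fun y => h (x + t • (y - x)) ^ 2) := by fun_prop
    exact ENNReal.measurable_ofReal.comp this.measurable
  have m2 : ∀ t : ℝ, Measurable (fun y => ENNReal.ofReal (h (x + t • (y - x)) ^ 2 * (t * ‖y - x‖))) := by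
    intro t
    have : Continuous (fun y => h (x + t • (y - x)) ^ 2 * (t * ‖y - x‖)) := by fun_prop
    exact ENNReal.measurable_ofReal.comp this.measurable
  have M1 : Measurable (fun t : ℝ => ∫⁻ y in T2, ENNReal.ofReal (h (x + t • (y - x)) ^ 2)) := by
    apply Measurable.lintegral_prod_right' (f := fun q : ℝ × (Fin 2 → ℝ) =>
      ENNReal.ofReal (h (x + q.1 • (q.2 - x)) ^ 2))
    have : Continuous (fun q : ℝ × (Fin 2 → ℝ) => h (x + q.1 • (q.2 - x)) ^ 2) := by fun_prop
    exact ENNReal.measurable_ofReal.comp this.measurable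
  have M2 : Measurable (fun t : ℝ => ∫⁻ y in T2,
      ENNReal.ofReal (h (x + t • (y - x)) ^ 2 * (t * ‖y - x‖))) := by
    apply Measurable.lintegral_prod_right' (f := fun q : ℝ × (Fin 2 → ℝ) =>
      ENNReal.ofReal (h (x + q.1 • (q.2 - x)) ^ 2 * (q.1 * ‖q.2 - x‖)))
    have : Continuous (fun q : ℝ × (Fin 2 → ℝ) =>
      h (x + q.1 • (q.2 - x)) ^ 2 * (q.1 * ‖q.2 - x‖)) := by fun_prop
    exact ENNReal.measurable_ofReal.comp this.measurable
  have inner : ∀ t ∈ Set.Ioc (0:ℝ) 1,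
      2 * ∫⁻ y in T2, ENNReal.ofReal (h (x + t • (y - x)) * ‖y - x‖) ≤
      ENNReal.ofReal α * (∫⁻ y in T2, ENNReal.ofReal (h (x + t • (y - x)) ^ 2))
      + ENNReal.ofReal l * (∫⁻ y in T2, ENNReal.ofReal (h (x + t • (y - x)) ^ 2 * (t * ‖y - x‖)))
      + ENNReal.ofReal ((α + l * t)⁻¹) := by
    intro t ht
    have hcst : ENNReal.ofReal ((α + l * t)⁻¹) = ∫⁻ _ in T2, ENNReal.ofReal ((α + l * t)⁻¹) := by
      rw [setLIntegral_const, T2_vol, mul_one]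
    rw [hcst, ← lintegral_const_mul _ (m1 t), ← lintegral_const_mul _ (m2 t),
      ← lintegral_add_left ((m1 t).const_mul _), ← lintegral_add_right _ measurable_const,
      ← lintegral_const_mul' _ _ (by simp)]
    apply setLIntegral_mono' T2_meas
    intro y hy
    have ht0 := ht.1
    rw [show (2 : ℝ≥0∞) = ENNReal.ofReal 2 by simp, ← ENNReal.ofReal_mul (by norm_num),
      ← ENNReal.ofReal_mul hα.le, ← ENNReal.ofReal_mul hl.le,
      ← ENNReal.ofReal_add (by positivity) (by positivity),
      ← ENNReal.ofReal_add (by positivity) (by positivity)]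
    exact ENNReal.ofReal_le_ofReal
      (amgm_kernel _ _ t α l (norm_nonneg _) (T2_dist hx hy) ht0 hα hl)
  calc ENNReal.ofReal (2 * ‖f x - ∫ y in T2, f y‖)
      = 2 * ENNReal.ofReal ‖f x - ∫ y in T2, f y‖ := by
        rw [ENNReal.ofReal_mul (by norm_num)]; simp
    _ ≤ 2 * ∫⁻ t in Set.Ioc (0:ℝ) 1, ∫⁻ y in T2, ENNReal.ofReal (h (x + t • (y - x)) * ‖y - x‖) := by
        gcongr
    _ = ∫⁻ t in Set.Ioc (0:ℝ) 1, 2 * ∫⁻ y in T2, ENNReal.ofReal (h (x + t • (y - x)) * ‖y - x‖) := by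
        rw [lintegral_const_mul' _ _ (by simp)]
    _ ≤ _ := setLIntegral_mono' measurableSet_Ioc inner
    _ = ENNReal.ofReal α * Waux h x
      + ENNReal.ofReal l * (∫⁻ t in Set.Ioc (0:ℝ) 1, ∫⁻ y in T2,
          ENNReal.ofReal (h (x + t • (y - x)) ^ 2 * (t * ‖y - x‖)))
      + ENNReal.ofReal (Real.log (1 + l / α) / l) := by
        have M3 : Measurable (fun t : ℝ => ENNReal.ofReal ((α + l * t)⁻¹)) := by fun_prop
        rw [lintegral_add_right _ M3,
          lintegral_add_left (M1.const_mul _), lintegral_const_mul _ M1, lintegral_const_mul _ M2,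
          integral_inv_lin α l hα hl, Waux]
    _ ≤ _ := by
        gcongr
        exact lintegral_F h hc x hx

/-- Pointwise Trudinger-type bound. -/
lemma pointwise_log (f : (Fin 2 → ℝ) → Fin 2 → ℝ) (hf : ContDiff ℝ 1 f) (G : ℝ) (hG : 0 < G)
    (hGf : ∫ z in T2, ‖fderiv ℝ f z‖ ^ 2 ≤ G) :
    ∃ W : (Fin 2 → ℝ) → ℝ, (∀ x, 0 ≤ W x) ∧ IntegrableOn W T2 ∧ (∫ x in T2, W x) ≤ 4 ∧
      ∀ᵐ x ∂(volume.restrict T2), ‖f x - ∫ y in T2, f y‖ ^ 2 ≤ 9 / 4 * G * Real.log (2 + W x) := by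
  set h : (Fin 2 → ℝ) → ℝ := fun z => ‖fderiv ℝ f z‖ with hh
  have hd : Continuous (fderiv ℝ f) := hf.continuous_fderiv one_ne_zero
  have hc : Continuous h := hd.norm
  have hG' : ∫⁻ z in T2, ENNReal.ofReal (h z ^ 2) ≤ ENNReal.ofReal G := by
    rw [← ofReal_integral_eq_lintegral_ofReal]
    · exact ENNReal.ofReal_le_ofReal hGf
    · exact (hc.pow 2).continuousOn.integrableOn_compact isCompact_Icc
    · exact Filter.Eventually.of_forall (fun z => by simp only [Pi.zero_apply]; positivity)
  have hWm := Waux_meas h hc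
  have hWi : ∫⁻ x in T2, Waux h x ≤ ENNReal.ofReal (4 * G) := by
    refine (lintegral_W h hc).trans ?_
    rw [ENNReal.ofReal_mul (by norm_num)]
    simp only [ENNReal.ofReal_ofNat]
    gcongr
  have hfin : ∫⁻ x in T2, Waux h x ≠ ∞ := ne_top_of_le_ne_top ENNReal.ofReal_ne_top hWi
  have hint : IntegrableOn (fun x => (Waux h x).toReal) T2 :=
    integrable_toReal_of_lintegral_ne_top hWm.aemeasurable hfin
  have hae : ∀ᵐ x ∂(volume.restrict T2), Waux h x < ∞ := ae_lt_top hWm hfin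
  refine ⟨fun x => (Waux h x).toReal / G, fun x => by positivity, hint.div_const G, ?_, ?_⟩
  · rw [integral_div, integral_toReal hWm.aemeasurable hae, div_le_iff₀ hG]
    exact ENNReal.toReal_le_of_le_ofReal (by positivity) hWi
  · filter_upwards [hae, ae_restrict_mem T2_meas] with x hxf hx
    set w := (Waux h x).toReal with hw
    have hw0 : 0 ≤ w := ENNReal.toReal_nonneg
    have hWw : Waux h x = ENNReal.ofReal w := (ENNReal.ofReal_toReal hxf.ne).symm
    set V := w / G with hV
    have hV0 : 0 ≤ V := by positivity
    set L := Real.log (2 + V) with hL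
    have hL0 : 0 < L := Real.log_pos (by linarith)
    set s := Real.sqrt L with hs
    have hs0 : 0 < s := Real.sqrt_pos.2 hL0
    have hsL : s ^ 2 = L := Real.sq_sqrt hL0.le
    set g := Real.sqrt G with hg
    have hg0 : 0 < g := Real.sqrt_pos.2 hG
    have hgG : g ^ 2 = G := Real.sq_sqrt hG.le
    have key := pointwise_lin f hf x hx (s / g / (1 + V)) (s / g) (by positivity) (by positivity)
    have key2 : ENNReal.ofReal (2 * ‖f x - ∫ y in T2, f y‖) ≤
        ENNReal.ofReal (s / g / (1 + V) * w + s / g * G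
          + Real.log (1 + s / g / (s / g / (1 + V))) / (s / g)) := by
      refine key.trans ?_
      have hlog : 0 ≤ Real.log (1 + s / g / (s / g / (1 + V))) :=
        Real.log_nonneg (by
          have : 0 ≤ s / g / (s / g / (1 + V)) := by positivity
          linarith)
      rw [ENNReal.ofReal_add (by positivity) (by positivity),
        ENNReal.ofReal_add (by positivity) (by positivity), ENNReal.ofReal_mul (by positivity),
        ENNReal.ofReal_mul (by positivity), ← hWw]
      gcongr
    have e1 : 1 + s / g / (s / g / (1 + V)) = 2 + V := by
      field_simp; ring
    rw [e1, ← hL, ENNReal.ofReal_le_ofReal_iff'] at key2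
    have e2 : s / g * G = s * g := by rw [← hgG]; field_simp
    have e3 : L / (s / g) = s * g := by rw [← hsL]; field_simp
    have e4 : s / g / (1 + V) * w ≤ s * g := by
      have : w = V * g ^ 2 := by rw [hV, hgG]; field_simp
      rw [this]
      have : s / g / (1 + V) * (V * g ^ 2) = s * g * (V / (1 + V)) := by field_simp
      rw [this]
      apply mul_le_of_le_one_right (by positivity)
      rw [div_le_one (by positivity)]; linarith
    have n0 := norm_nonneg (f x - ∫ y in T2, f y)
    have e5 : 2 * ‖f x - ∫ y in T2, f y‖ ≤ 3 * (s * g) := by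
      rcases key2 with h1 | h1
      · linarith
      · have : 0 ≤ s * g := by positivity
        linarith
    calc ‖f x - ∫ y in T2, f y‖ ^ 2 ≤ (3 / 2 * (s * g)) ^ 2 := by
          apply pow_le_pow_left₀ n0; linarith
      _ = 9 / 4 * (g ^ 2) * (s ^ 2) := by ring
      _ = _ := by rw [hgG, hsL]

lemma opnorm_bound (f : (Fin 2 → ℝ) → Fin 2 → ℝ) (hf : ContDiff ℝ 1 f) (x : Fin 2 → ℝ) :
    ‖fderiv ℝ f x‖ ^ 2 ≤ 2 * ∑ i, ∑ j, (pd (fun y => f y j) i x) ^ 2 := by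
  have hdf := hf.differentiable one_ne_zero x
  have hpd : ∀ i j, pd (fun y => f y j) i x = fderiv ℝ f x (Pi.single i 1) j := by
    intro i j
    unfold pd
    have := (hasFDerivAt_pi'.1 hdf.hasFDerivAt) j
    rw [this.fderiv]; rfl
  simp_rw [hpd]
  set A := fderiv ℝ f x with hA
  set S := ∑ i, ∑ j, (A (Pi.single i 1) j) ^ 2 with hS
  have hS0 : 0 ≤ S := by positivity
  have : ‖A‖ ≤ Real.sqrt (2 * S) := by
    apply ContinuousLinearMap.opNorm_le_bound _ (Real.sqrt_nonneg _)
    intro v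
    rw [pi_norm_le_iff_of_nonneg (by positivity)]
    intro j
    have hv : v = v 0 • Pi.single 0 1 + v 1 • Pi.single 1 1 := by
      ext k; fin_cases k <;> simp
    have e : A v j = v 0 * A (Pi.single 0 1) j + v 1 * A (Pi.single 1 1) j := by
      conv_lhs => rw [hv, map_add, map_smul, map_smul]
      simp
    rw [e, Real.norm_eq_abs]
    have h0 : |v 0| ≤ ‖v‖ := norm_le_pi_norm v 0
    have h1 : |v 1| ≤ ‖v‖ := norm_le_pi_norm v 1
    set a := A (Pi.single 0 1) j
    set b := A (Pi.single 1 1) j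
    have hab : a ^ 2 + b ^ 2 ≤ S := by
      rw [hS, Fin.sum_univ_two]
      have q0 : a ^ 2 ≤ ∑ j, (A (Pi.single 0 1) j) ^ 2 :=
        Finset.single_le_sum (f := fun j => (A (Pi.single 0 1) j) ^ 2)
          (fun _ _ => sq_nonneg _) (Finset.mem_univ j)
      have q1 : b ^ 2 ≤ ∑ j, (A (Pi.single 1 1) j) ^ 2 :=
        Finset.single_le_sum (f := fun j => (A (Pi.single 1 1) j) ^ 2)
          (fun _ _ => sq_nonneg _) (Finset.mem_univ j)
      linarith
    have h2 : |a| + |b| ≤ Real.sqrt (2 * S) := by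
      apply Real.le_sqrt_of_sq_le
      nlinarith [sq_nonneg (|a| - |b|), sq_abs a, sq_abs b]
    calc |v 0 * a + v 1 * b| ≤ |v 0| * |a| + |v 1| * |b| := by
          rw [← abs_mul, ← abs_mul]; exact abs_add_le _ _
      _ ≤ ‖v‖ * |a| + ‖v‖ * |b| := by gcongr
      _ = (|a| + |b|) * ‖v‖ := by ring
      _ ≤ _ := by gcongr
  calc ‖A‖ ^ 2 ≤ Real.sqrt (2 * S) ^ 2 := by gcongr
    _ = 2 * S := Real.sq_sqrt (by positivity)

lemma log_le_four_rpow (D : ℝ) (hD : 0 < D) : Real.log D ≤ 4 * Real.sqrt (Real.sqrt D) := by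
  have h1 : Real.log (Real.sqrt (Real.sqrt D)) = Real.log D / 4 := by
    rw [Real.log_sqrt (Real.sqrt_nonneg _), Real.log_sqrt hD.le]; ring
  have h2 := Real.log_le_self (Real.sqrt_nonneg (Real.sqrt D))
  linarith

lemma mean_pointwise (r D S : ℝ) (hr : 0 ≤ r) (hD : 2 ≤ D) (hS : 1 ≤ S) :
    r * Real.log D ≤ 2 * Real.log S * r + 2 * (r ^ 2 / S + D) := by
  have hD0 : 0 < D := by linarith
  have hS0 : 0 < S := by linarith
  rcases le_or_gt D (S ^ 2) with h | h
  · have h1 : Real.log D ≤ 2 * Real.log S := by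
      have := Real.log_le_log hD0 h
      rw [Real.log_pow] at this; simpa using this
    have h2 : r * Real.log D ≤ r * (2 * Real.log S) := by gcongr
    have h3 : 0 ≤ r ^ 2 / S := by positivity
    linarith
  · set u := Real.sqrt D with hu
    have hu0 : 0 < u := Real.sqrt_pos.2 hD0
    have huD : u ^ 2 = D := Real.sq_sqrt hD0.le
    set v := Real.sqrt u with hv
    have hvu : v ^ 2 = u := Real.sq_sqrt hu0.le
    have hSu : S ≤ u := Real.le_sqrt_of_sq_le h.le
    have h1 : Real.log D ≤ 4 * v := log_le_four_rpow D hD0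
    have h2 : r * Real.log D ≤ r * (4 * v) := by gcongr
    have h3 : 2 * (r * v) ≤ r ^ 2 / S + S * v ^ 2 := by
      have : r ^ 2 / S + S * v ^ 2 - 2 * (r * v) = (r - S * v) ^ 2 / S := by
        field_simp; ring
      have h4 : 0 ≤ (r - S * v) ^ 2 / S := by positivity
      linarith
    have h5 : S * v ^ 2 ≤ D := by rw [hvu, ← huD]; nlinarith
    have h6 : 0 ≤ 2 * Real.log S * r := by
      have := Real.log_nonneg hS; positivity
    linarith

lemma main_pointwise (q K G A T R : ℝ) (hq : 0 < q) (hK : 0 < K) (hG : 0 < G) (hA : 0 < A)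
    (hR : 0 < R) (hT : 1 < T) (hTR : R * G / A ≤ T) (r F D : ℝ) (hr : 0 ≤ r) (hrR : r ≤ R)
    (hF : 0 ≤ F) (hD : 2 ≤ D) (hFb : F ≤ K * G * (Real.log T + Real.log D)) :
    r * F ^ (q + 1) ≤ (3 * K * G * Real.log T) ^ q * (r * F)
      + ((2 * K) ^ (q + 1) * (2 * (q + 1)) ^ (q + 1)) * G ^ q * A * D := by
  have hD0 : 0 < D := by linarith
  have hT0 : 0 < T := by linarith
  have hl : 0 < Real.log T := Real.log_pos hT
  have hlD : 0 < Real.log D := Real.log_pos (by linarith)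
  rcases le_or_gt D (T ^ 2) with h | h
  · have h1 : Real.log D ≤ 2 * Real.log T := by
      have := Real.log_le_log hD0 h
      rw [Real.log_pow] at this; simpa using this
    have h2 : F ≤ 3 * K * G * Real.log T := by
      refine hFb.trans ?_
      have : K * G * (Real.log T + Real.log D) ≤ K * G * (3 * Real.log T) := by
        gcongr; linarith
      linarith
    have h3 : r * F ^ (q + 1) ≤ (3 * K * G * Real.log T) ^ q * (r * F) := by
      rw [Real.rpow_add_one' hF (by positivity)]
      calc r * (F ^ q * F) = F ^ q * (r * F) := by ring
        _ ≤ _ := by gcongr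
    have h4 : 0 ≤ ((2 * K) ^ (q + 1) * (2 * (q + 1)) ^ (q + 1)) * G ^ q * A * D := by positivity
    linarith
  · set u := Real.sqrt D with hu
    have hu0 : 0 < u := Real.sqrt_pos.2 hD0
    have huD : u ^ 2 = D := Real.sq_sqrt hD0.le
    have hTu : T ≤ u := Real.le_sqrt_of_sq_le h.le
    have h1 : Real.log T ≤ Real.log D := Real.log_le_log hT0 (by nlinarith)
    have h2 : F ≤ 2 * K * G * Real.log D := by
      refine hFb.trans ?_
      have : K * G * (Real.log T + Real.log D) ≤ K * G * (2 * Real.log D) := by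
        gcongr; linarith
      linarith
    have hε : 0 < 1 / (2 * (q + 1)) := by positivity
    have h3 : Real.log D ≤ 2 * (q + 1) * D ^ (1 / (2 * (q + 1))) := by
      have := Real.log_le_rpow_div hD0.le hε
      rw [div_div_eq_mul_div, div_one] at this
      linarith
    have h4 : (Real.log D) ^ (q + 1) ≤ (2 * (q + 1)) ^ (q + 1) * u := by
      calc (Real.log D) ^ (q + 1) ≤ (2 * (q + 1) * D ^ (1 / (2 * (q + 1)))) ^ (q + 1) := by gcongr
        _ = (2 * (q + 1)) ^ (q + 1) * D ^ (1 / (2 * (q + 1)) * (q + 1)) := by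
            rw [Real.mul_rpow (by positivity) (by positivity), ← Real.rpow_mul hD0.le]
        _ = _ := by
            rw [hu, Real.sqrt_eq_rpow]; congr 2; field_simp
    have h5 : R * G * u ≤ A * D := by
      rw [div_le_iff₀ hA] at hTR
      calc R * G * u ≤ T * A * u := by gcongr
        _ ≤ u * A * u := by gcongr
        _ = A * D := by rw [← huD]; ring
    have h6 : r * F ^ (q + 1) ≤
        ((2 * K) ^ (q + 1) * (2 * (q + 1)) ^ (q + 1)) * G ^ q * A * D := by
      calc r * F ^ (q + 1) ≤ R * (2 * K * G * Real.log D) ^ (q + 1) := by gcongr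
        _ = (2 * K) ^ (q + 1) * G ^ q * (R * G) * (Real.log D) ^ (q + 1) := by
            rw [Real.mul_rpow (by positivity) (by positivity),
              Real.mul_rpow (by positivity) (by positivity), Real.rpow_add_one hG.ne']
            ring
        _ ≤ (2 * K) ^ (q + 1) * G ^ q * (R * G) * ((2 * (q + 1)) ^ (q + 1) * u) := by gcongr
        _ = ((2 * K) ^ (q + 1) * (2 * (q + 1)) ^ (q + 1)) * G ^ q * (R * G * u) := by ring
        _ ≤ ((2 * K) ^ (q + 1) * (2 * (q + 1)) ^ (q + 1)) * G ^ q * (A * D) := by gcongr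
        _ = _ := by ring
    have h7 : 0 ≤ (3 * K * G * Real.log T) ^ q * (r * F) := by positivity
    linarith

lemma weight_integrable (ρ : (Fin 2 → ℝ) → ℝ) (ρM : ℝ) (hm : Measurable ρ) (h0 : ∀ x, 0 ≤ ρ x)
    (h1 : ∀ x, ρ x ≤ ρM) (c : (Fin 2 → ℝ) → ℝ) (hc : IntegrableOn c T2) :
    IntegrableOn (fun x => ρ x * c x) T2 := by
  refine Integrable.bdd_mul (c := ρM) hc hm.aestronglyMeasurable
    (Filter.Eventually.of_forall fun x => ?_)
  rw [Real.norm_of_nonneg (h0 x)]; exact h1 x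

lemma mean_bound (ρ : (Fin 2 → ℝ) → ℝ) (ρM M : ℝ) (hm : Measurable ρ) (h0 : ∀ x, 0 ≤ ρ x)
    (h1 : ∀ x, ρ x ≤ ρM) (hM : M = ∫ x in T2, ρ x) (hM0 : 0 < M)
    (f : (Fin 2 → ℝ) → Fin 2 → ℝ) (hf : Continuous f)
    (hmean : ∀ i, (∫ x in T2, ρ x * f x i) = 0) (G : ℝ) (hG : 0 < G)
    (W : (Fin 2 → ℝ) → ℝ) (hW0 : ∀ x, 0 ≤ W x) (hWi : IntegrableOn W T2)
    (hW4 : (∫ x in T2, W x) ≤ 4)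
    (hX : ∀ᵐ x ∂(volume.restrict T2),
      ‖f x - ∫ y in T2, f y‖ ^ 2 ≤ 9 / 2 * G * Real.log (2 + W x)) :
    ‖∫ y in T2, f y‖ ^ 2 ≤
      1369 * (G * Real.log (Real.exp 1 + (∫ x in T2, (ρ x - M) ^ 2) / M ^ 2)) := by
  have : IsFiniteMeasure (volume.restrict T2) := ⟨by simp [T2_vol]⟩
  have hone : ∀ c : ℝ, ∫ _ in T2, c = c := by
    intro c; simp [Measure.real, T2_vol]
  have wi := weight_integrable ρ ρM hm h0 h1
  have ci : ∀ c : (Fin 2 → ℝ) → ℝ, Continuous c → IntegrableOn c T2 := fun c hc =>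
    hc.continuousOn.integrableOn_compact isCompact_Icc
  have ρi : IntegrableOn ρ T2 := by simpa using wi (fun _ => 1) (ci _ continuous_const)
  have ρ2i : IntegrableOn (fun x => ρ x ^ 2) T2 := by
    simpa [sq] using wi ρ ρi
  set S0 := (∫ x in T2, (ρ x - M) ^ 2) / M ^ 2 with hS0
  have hS00 : 0 ≤ S0 := by positivity
  have hS2 : ∫ x in T2, ρ x ^ 2 = M ^ 2 * (1 + S0) := by
    have : ∫ x in T2, (ρ x - M) ^ 2 = (∫ x in T2, ρ x ^ 2) - M ^ 2 := by
      have e : ∀ x, (ρ x - M) ^ 2 = ρ x ^ 2 - 2 * M * ρ x + M ^ 2 := fun x => by ring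
      have i7 : IntegrableOn (fun x => ρ x ^ 2 - 2 * M * ρ x) T2 := ρ2i.sub (ρi.const_mul _)
      simp_rw [e]
      rw [integral_add i7 (integrable_const _),
        integral_sub ρ2i (ρi.const_mul _), integral_const_mul, ← hM, hone]
      ring
    rw [hS0, this]; field_simp; ring
  set S := Real.exp 1 + S0 with hS
  have he : 1 ≤ Real.exp 1 := Real.one_le_exp (by norm_num)
  have hS1 : 1 + S0 ≤ S := by rw [hS]; linarith
  have hSpos : 0 < S := by linarith
  set l := Real.log S with hl
  have hl1 : 1 ≤ l := by
    rw [hl, Real.le_log_iff_exp_le hSpos]; linarith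
  set m := Real.sqrt (G * l) with hmm
  have hGl : 0 < G * l := by positivity
  have hm0 : 0 < m := Real.sqrt_pos.2 hGl
  have hm2 : m ^ 2 = G * l := Real.sq_sqrt hGl.le
  set fb := ∫ y in T2, f y with hfb
  have hfi : IntegrableOn f T2 := hf.continuousOn.integrableOn_compact isCompact_Icc
  have Xc : Continuous (fun x => ‖f x - fb‖) := by fun_prop
  -- the majorant
  set B : (Fin 2 → ℝ) → ℝ := fun x =>
    9 / 4 * (G / m) * (2 * l * (ρ x / M) + 2 * ((ρ x ^ 2) / M ^ 2 / S + (2 + W x)))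
      + m / 2 * (ρ x / M) with hB
  have i1 : IntegrableOn (fun x => 2 * l * (ρ x / M)) T2 := (ρi.div_const M).const_mul _
  have i2 : IntegrableOn (fun x => (ρ x ^ 2) / M ^ 2 / S) T2 := (ρ2i.div_const _).div_const _
  have i3 : IntegrableOn (fun x => 2 + W x) T2 := (integrable_const (2:ℝ)).add hWi
  have i4 : IntegrableOn (fun x => 2 * ((ρ x ^ 2) / M ^ 2 / S + (2 + W x))) T2 :=
    (i2.add i3).const_mul _
  have i5 : IntegrableOn (fun x => 9 / 4 * (G / m) *
    (2 * l * (ρ x / M) + 2 * ((ρ x ^ 2) / M ^ 2 / S + (2 + W x)))) T2 := (i1.add i4).const_mul _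
  have i6 : IntegrableOn (fun x => m / 2 * (ρ x / M)) T2 := (ρi.div_const M).const_mul _
  have hBi : IntegrableOn B T2 := i5.add i6
  have hBint : ∫ x in T2, B x ≤ 37 * m := by
    have e : ∫ x in T2, B x = 9 / 4 * (G / m) * (2 * l * (M / M) + 2 * ((M ^ 2 * (1 + S0)) / M ^ 2 / S
        + (2 + ∫ x in T2, W x))) + m / 2 * (M / M) := by
      rw [hB, integral_add i5 i6, integral_const_mul, integral_add i1 i4, integral_const_mul,
        integral_const_mul, integral_add i2 i3, integral_div, integral_div, integral_div, hS2,
        integral_add (integrable_const _) hWi, hone, integral_const_mul, integral_div, ← hM]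
    rw [e, div_self hM0.ne', mul_div_cancel_left₀ _ (by positivity)]
    have h2 : (1 + S0) / S ≤ 1 := by rw [div_le_one hSpos]; exact hS1
    have h3 : 2 * l * 1 + 2 * ((1 + S0) / S + (2 + ∫ x in T2, W x)) ≤ 16 * l := by linarith
    have h4 : 9 / 4 * (G / m) * (2 * l * 1 + 2 * ((1 + S0) / S + (2 + ∫ x in T2, W x)))
        ≤ 9 / 4 * (G / m) * (16 * l) := by gcongr
    have h5 : 9 / 4 * (G / m) * (16 * l) = 36 * m := by
      have : 9 / 4 * (G / m) * (16 * l) = 36 * (G * l) / m := by ring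
      rw [this, ← hm2]; field_simp
    linarith
  have hXB : ∀ᵐ x ∂(volume.restrict T2), ρ x / M * ‖f x - fb‖ ≤ B x := by
    filter_upwards [hX] with x hx
    have hr : 0 ≤ ρ x / M := div_nonneg (h0 x) hM0.le
    have k1 := mean_pointwise (ρ x / M) (2 + W x) S hr (by linarith [hW0 x]) (by linarith)
    set X := ‖f x - fb‖ with hXd
    have k2 : X ≤ X ^ 2 / m / 2 + m / 2 := by
      have : X ^ 2 / m / 2 + m / 2 - X = (X - m) ^ 2 / (2 * m) := by field_simp; ring
      have h4 : 0 ≤ (X - m) ^ 2 / (2 * m) := by positivity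
      linarith
    have k3 : X ^ 2 / m / 2 ≤ 9 / 4 * (G / m) * Real.log (2 + W x) := by
      have : X ^ 2 / m / 2 ≤ (9 / 2 * G * Real.log (2 + W x)) / m / 2 := by gcongr
      refine this.trans (le_of_eq (by ring))
    calc ρ x / M * X ≤ ρ x / M * (9 / 4 * (G / m) * Real.log (2 + W x) + m / 2) := by
          gcongr; linarith
      _ = 9 / 4 * (G / m) * (ρ x / M * Real.log (2 + W x)) + m / 2 * (ρ x / M) := by ring
      _ ≤ 9 / 4 * (G / m) * (2 * Real.log S * (ρ x / M) + 2 * ((ρ x / M) ^ 2 / S + (2 + W x)))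
          + m / 2 * (ρ x / M) := by gcongr
      _ = B x := by rw [hB, div_pow]
  have hXi : IntegrableOn (fun x => ρ x / M * ‖f x - fb‖) T2 := by
    have := (wi _ (ci _ Xc)).div_const M
    refine this.congr (Filter.Eventually.of_forall fun x => ?_)
    simp only; ring
  have hfbn : ‖fb‖ ≤ 37 * m := by
    rw [pi_norm_le_iff_of_nonneg (by positivity)]
    intro i
    have fci : Continuous (fun x => f x i) := (continuous_apply i).comp hf
    have a1 : ∫ x in T2, ρ x / M * (fb i - f x i) = fb i := by
      have e : ∀ x, ρ x / M * (fb i - f x i) = fb i / M * ρ x - (ρ x * f x i) / M := fun x => by ring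
      simp_rw [e]
      rw [integral_sub (ρi.const_mul _) ((wi _ (ci _ fci)).div_const M), integral_const_mul,
        integral_div, hmean, ← hM]
      field_simp; simp
    rw [← a1]
    calc ‖∫ x in T2, ρ x / M * (fb i - f x i)‖ ≤ ∫ x in T2, ‖ρ x / M * (fb i - f x i)‖ :=
          norm_integral_le_integral_norm _
      _ ≤ ∫ x in T2, ρ x / M * ‖f x - fb‖ := by
          apply integral_mono_of_nonneg (Filter.Eventually.of_forall fun x => norm_nonneg _) hXi
          refine Filter.Eventually.of_forall fun x => ?_
          simp only
          rw [norm_mul, Real.norm_of_nonneg (div_nonneg (h0 x) hM0.le)]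
          have := norm_le_pi_norm (f x - fb) i
          rw [Pi.sub_apply, norm_sub_rev] at this
          exact mul_le_mul_of_nonneg_left this (div_nonneg (h0 x) hM0.le)
      _ ≤ ∫ x in T2, B x := integral_mono_ae hXi hBi hXB
      _ ≤ 37 * m := hBint
  calc ‖fb‖ ^ 2 ≤ (37 * m) ^ 2 := by gcongr
    _ = 1369 * m ^ 2 := by ring
    _ = _ := by rw [hm2]

theorem main_aux (q : ℝ) (hq : 0 < q) :
    ∃ C > 0, ∀ (ρ : (Fin 2 → ℝ) → ℝ) (ρM M A : ℝ) (f : (Fin 2 → ℝ) → Fin 2 → ℝ),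
      Measurable ρ → (∀ x, 0 ≤ ρ x) → (∀ x, ρ x ≤ ρM) → 0 < ρM → 0 < M →
      ContDiff ℝ 1 f →
      (∀ i, (∫ x in T2, ρ x * f x i) = 0) →
      A = (∫ x in T2, ρ x * ∑ i, (f x i) ^ 2) → 0 < A →
      M = (∫ x in T2, ρ x) → ∀ G : ℝ, 0 < G → (∫ z in T2, ‖fderiv ℝ f z‖ ^ 2) ≤ 2 * G →
      (∫ x in T2, ρ x * (∑ i, (f x i) ^ 2) ^ (q + 1))
        ≤ C * A * G ^ q * (Real.log (Real.exp 1
                + (∫ x in T2, (ρ x - M) ^ 2) / M ^ 2 + ρM * G / A)) ^ q := by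
  set K : ℝ := 5476 with hK
  set C2 : ℝ := (2 * K) ^ (q + 1) * (2 * (q + 1)) ^ (q + 1) with hC2
  have hC20 : 0 < C2 := by positivity
  refine ⟨(3 * K) ^ q + 6 * C2, by positivity, ?_⟩
  intro ρ ρM M A f hm h0 h1 hρM hM0 hf hmean hA hA0 hM G hG hGf
  have : IsFiniteMeasure (volume.restrict T2) := ⟨by simp [T2_vol]⟩
  have hone : ∀ c : ℝ, ∫ _ in T2, c = c := by
    intro c; simp [Measure.real, T2_vol]
  have wi := weight_integrable ρ ρM hm h0 h1
  have ci : ∀ c : (Fin 2 → ℝ) → ℝ, Continuous c → IntegrableOn c T2 := fun c hc =>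
    hc.continuousOn.integrableOn_compact isCompact_Icc
  obtain ⟨W, hW0, hWi, hW4, hX⟩ := pointwise_log f hf (2 * G) (by positivity) hGf
  have hX' : ∀ᵐ x ∂(volume.restrict T2),
      ‖f x - ∫ y in T2, f y‖ ^ 2 ≤ 9 / 2 * G * Real.log (2 + W x) := by
    filter_upwards [hX] with x hx
    linarith
  have hmb := mean_bound ρ ρM M hm h0 h1 hM hM0 f hf.continuous hmean G hG W hW0 hWi hW4 hX'
  set S0 := (∫ x in T2, (ρ x - M) ^ 2) / M ^ 2 with hS0
  have hS00 : 0 ≤ S0 := by positivity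
  set T := Real.exp 1 + S0 + ρM * G / A with hT
  have hRG : 0 ≤ ρM * G / A := by positivity
  have he : 1 < Real.exp 1 := Real.one_lt_exp_iff.2 (by norm_num)
  have hT1 : 1 < T := by rw [hT]; linarith
  have hl1 : 1 ≤ Real.log T := by
    rw [Real.le_log_iff_exp_le (by linarith)]; linarith
  have hll : Real.log (Real.exp 1 + S0) ≤ Real.log T :=
    Real.log_le_log (by linarith) (by linarith)
  set F : (Fin 2 → ℝ) → ℝ := fun x => ∑ i, (f x i) ^ 2 with hF
  have hF0 : ∀ x, 0 ≤ F x := fun x => by positivity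
  have hfc := hf.continuous
  have hFc : Continuous F := by
    apply continuous_finsetSum
    intro i _
    exact ((continuous_apply i).comp hfc).pow 2
  have hFpc : Continuous (fun x => F x ^ (q + 1)) :=
    hFc.rpow_const (fun x => Or.inr (by positivity))
  have hFb : ∀ᵐ x ∂(volume.restrict T2),
      F x ≤ K * G * (Real.log T + Real.log (2 + W x)) := by
    filter_upwards [hX'] with x hx
    have hD0 : 0 ≤ Real.log (2 + W x) := Real.log_nonneg (by linarith [hW0 x])
    set fb := ∫ y in T2, f y
    have b1 : F x ≤ 2 * ‖f x‖ ^ 2 := by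
      simp only [hF, Fin.sum_univ_two]
      have c0 : |f x 0| ≤ ‖f x‖ := norm_le_pi_norm (f x) 0
      have c1 : |f x 1| ≤ ‖f x‖ := norm_le_pi_norm (f x) 1
      have d0 : (f x 0) ^ 2 ≤ ‖f x‖ ^ 2 := by rw [← sq_abs]; gcongr
      have d1 : (f x 1) ^ 2 ≤ ‖f x‖ ^ 2 := by rw [← sq_abs]; gcongr
      linarith
    have b2 : ‖f x‖ ≤ ‖f x - fb‖ + ‖fb‖ := by
      have := norm_add_le (f x - fb) fb
      simpa using this
    have b3 : ‖f x‖ ^ 2 ≤ 2 * ‖f x - fb‖ ^ 2 + 2 * ‖fb‖ ^ 2 := by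
      have : ‖f x‖ ^ 2 ≤ (‖f x - fb‖ + ‖fb‖) ^ 2 := by gcongr
      nlinarith [sq_nonneg (‖f x - fb‖ - ‖fb‖)]
    have b4 : G * Real.log (Real.exp 1 + S0) ≤ G * Real.log T := by gcongr
    have b5 : 0 ≤ G * Real.log (2 + W x) := by positivity
    rw [hK]
    nlinarith
  have hpt : ∀ᵐ x ∂(volume.restrict T2), ρ x * F x ^ (q + 1) ≤
      (3 * K * G * Real.log T) ^ q * (ρ x * F x) + C2 * G ^ q * A * (2 + W x) := by
    filter_upwards [hFb] with x hx
    exact main_pointwise q K G A T ρM hq (by norm_num) hG hA0 hρM hT1 (by rw [hT]; linarith)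
      (ρ x) (F x) (2 + W x) (h0 x) (h1 x) (hF0 x) (by linarith [hW0 x]) hx
  have j1 : IntegrableOn (fun x => ρ x * F x) T2 := wi F (ci F hFc)
  have j3 : IntegrableOn (fun x => 2 + W x) T2 := (integrable_const (2:ℝ)).add hWi
  have hlq : 1 ≤ Real.log T ^ q := Real.one_le_rpow hl1 hq.le
  calc ∫ x in T2, ρ x * F x ^ (q + 1)
      ≤ ∫ x in T2, ((3 * K * G * Real.log T) ^ q * (ρ x * F x) + C2 * G ^ q * A * (2 + W x)) :=
        integral_mono_ae (wi _ (ci _ hFpc)) ((j1.const_mul _).add (j3.const_mul _)) hpt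
    _ = (3 * K * G * Real.log T) ^ q * A + C2 * G ^ q * A * (2 + ∫ x in T2, W x) := by
        rw [integral_add (j1.const_mul _) (j3.const_mul _), integral_const_mul,
          integral_const_mul, integral_add (integrable_const _) hWi, hone, ← hA]
    _ ≤ (3 * K * G * Real.log T) ^ q * A + C2 * G ^ q * A * (6 * Real.log T ^ q) := by
        gcongr; linarith
    _ = _ := by
        rw [Real.mul_rpow (by positivity) (by linarith), Real.mul_rpow (by positivity) hG.le]
        ring

/-- logarithmic Gagliardo–Nirenberg-type inequality on the torus
with a nonnegative bounded weight `ρ` (Desjardins' inequality).  Here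
`M = ∫_{𝕋²} ρ dx`, `‖√ρ f‖² = ∫ ρ|f|²` and `‖∇f‖² = ∫ Σ_{i,j} |∂_i f_j|²`. -/
theorem weighted_log_gagliardo_nirenberg_on_torus
    (p : ℝ) (hp : 2 < p) :
    ∃ C > 0, ∀ (ρ : (Fin 2 → ℝ) → ℝ) (ρM M : ℝ) (f : (Fin 2 → ℝ) → Fin 2 → ℝ),
      Per ρ → (∀ i, Per fun x => f x i) →
      Measurable ρ → (∀ x, 0 ≤ ρ x) → (∀ x, ρ x ≤ ρM) → 0 < ρM →
      ¬ (∀ᵐ x ∂(volume.restrict T2), ρ x = 0) →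
      ContDiff ℝ 1 f →
      (∀ i, (∫ x in T2, ρ x * f x i) = 0) →
      (∫ x in T2, ρ x * ∑ i, (f x i) ^ 2) ≠ 0 →
      M = (∫ x in T2, ρ x) →
      (∫ x in T2, ρ x * (∑ i, (f x i) ^ 2) ^ (p / 2))
        ≤ C * (∫ x in T2, ρ x * ∑ i, (f x i) ^ 2)
            * (∫ x in T2, ∑ i, ∑ j, (pd (fun y => f y j) i x) ^ 2) ^ ((p - 2) / 2)
            * (Real.log (Real.exp 1
                + (∫ x in T2, (ρ x - M) ^ 2) / M ^ 2
                + ρM * (∫ x in T2, ∑ i, ∑ j, (pd (fun y => f y j) i x) ^ 2)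
                    / (∫ x in T2, ρ x * ∑ i, (f x i) ^ 2))) ^ ((p - 2) / 2) := by
  obtain ⟨C, hC, hmain⟩ := main_aux ((p - 2) / 2) (by linarith)
  refine ⟨C, hC, ?_⟩
  intro ρ ρM M f _ _ hm h0 h1 hρM hne hf hmean hA hM
  have hpq : p / 2 = (p - 2) / 2 + 1 := by ring
  have hq : 0 < (p - 2) / 2 := by linarith
  set A := ∫ x in T2, ρ x * ∑ i, (f x i) ^ 2 with hAd
  set G := ∫ x in T2, ∑ i, ∑ j, (pd (fun y => f y j) i x) ^ 2 with hGd
  set q := (p - 2) / 2 with hqd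
  have : IsFiniteMeasure (volume.restrict T2) := ⟨by simp [T2_vol]⟩
  have ci : ∀ c : (Fin 2 → ℝ) → ℝ, Continuous c → IntegrableOn c T2 := fun c hc =>
    hc.continuousOn.integrableOn_compact isCompact_Icc
  have hA0 : 0 < A := by
    refine lt_of_le_of_ne (integral_nonneg fun x => ?_) (Ne.symm hA)
    exact mul_nonneg (h0 x) (by positivity)
  have hG0 : 0 ≤ G := integral_nonneg fun x => by simp only [Pi.zero_apply]; positivity
  have ρi : IntegrableOn ρ T2 := by
    simpa using weight_integrable ρ ρM hm h0 h1 (fun _ => 1) (ci _ continuous_const)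
  have hM0 : 0 < M := by
    rw [hM]
    refine lt_of_le_of_ne (integral_nonneg fun x => h0 x) (fun h => hne ?_)
    exact (integral_eq_zero_iff_of_nonneg (fun x => h0 x) ρi).1 h.symm
  have hS0 : 0 ≤ (∫ x in T2, (ρ x - M) ^ 2) / M ^ 2 := by positivity
  have hd : Continuous (fderiv ℝ f) := hf.continuous_fderiv one_ne_zero
  have hpdc : ∀ i j, Continuous (pd (fun y => f y j) i) := by
    intro i j
    have hfj : ContDiff ℝ 1 (fun y => f y j) := contDiff_pi.1 hf j
    exact (hfj.continuous_fderiv one_ne_zero).clm_apply continuous_const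
  have hGf : (∫ z in T2, ‖fderiv ℝ f z‖ ^ 2) ≤ 2 * G := by
    rw [hGd, ← integral_const_mul]
    apply integral_mono (ci _ (hd.norm.pow 2))
    · refine (ci _ ?_).const_mul 2
      exact continuous_finsetSum _ fun i _ => continuous_finsetSum _ fun j _ => (hpdc i j).pow 2
    · intro x
      exact opnorm_bound f hf x
  set S0 := (∫ x in T2, (ρ x - M) ^ 2) / M ^ 2 with hS0d
  rw [hpq]
  have hcont : ContinuousAt (fun g : ℝ => C * A * g ^ q *
      (Real.log (Real.exp 1 + S0 + ρM * g / A)) ^ q) G := by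
    have hpos : 0 < Real.exp 1 + S0 + ρM * G / A := by positivity
    have c1 : ContinuousAt (fun g : ℝ => g ^ q) G :=
      (Real.continuous_rpow_const hq.le).continuousAt
    have c2 : ContinuousAt (fun g : ℝ => Real.log (Real.exp 1 + S0 + ρM * g / A)) G :=
      ContinuousAt.log (by fun_prop) hpos.ne'
    exact (continuousAt_const.mul c1).mul
      ((Real.continuous_rpow_const hq.le).continuousAt.comp c2)
  have hlim : Filter.Tendsto (fun g : ℝ => C * A * g ^ q *
      (Real.log (Real.exp 1 + S0 + ρM * g / A)) ^ q) (nhdsWithin G (Set.Ioi G))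
      (nhds (C * A * G ^ q * (Real.log (Real.exp 1 + S0 + ρM * G / A)) ^ q)) :=
    hcont.tendsto.mono_left nhdsWithin_le_nhds
  refine ge_of_tendsto hlim ?_
  filter_upwards [self_mem_nhdsWithin] with g hg
  have hg' : G < g := hg
  exact hmain ρ ρM M A f hm h0 h1 hρM hM0 hf hmean hAd hA0 hM g (by linarith) (by linarith)
end
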